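/- Let f(Z), g(Z) ∈ ℤ[Z] satisfy the nondegeneracy condition. Then for every ε > 0 there is a constant C (depending only on f, g, ε) such that for all real T ≥ 1, x ≥ 2 and every sequence of integers 𝔄 = (a_p) indexed by the primes, one has Σ_{t ∈ F(T), Δ(t) ≠ 0} π_{E(t)}(𝔄; x) ≤ C (T x^{11/8+ε} + T² x^{7/8}); moreover, if 𝔄 is the zero sequence (a_p = 0 for all p), then Σ_{t ∈ F(T), Δ(t) ≠ 0} π_{E(t)}(𝔄; x) ≤ C (T x^{4/3+ε} + T² x^{5/6}). -/

import Mathlib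

open Polynomial Finset

attribute [local instance 10] Classical.propDecidable

noncomputable section

/-- The discriminant polynomial `Δ = -16(4f³+27g²)`. -/
def Dpoly (f g : Polynomial ℤ) : Polynomial ℤ := -16 * (4 * f ^ 3 + 27 * g ^ 2)

/-- Nondegeneracy: `Δ ≠ 0` as a polynomial and the `j`-invariant
`j = -1728(4f)³/Δ` is not a constant rational function, i.e. `-1728(4f)³`
is not a rational multiple of `Δ`. -/
def Nondeg (f g : Polynomial ℤ) : Prop :=
  Dpoly f g ≠ 0 ∧
    ¬∃ c : ℚ, (-1728 : Polynomial ℚ) * (4 * f.map (Int.castRingHom ℚ)) ^ 3 =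
      Polynomial.C c * (Dpoly f g).map (Int.castRingHom ℚ)

/-- The set `F(T) = {u/v ∈ ℚ : gcd(u,v) = 1, 1 ≤ u, v ≤ T}`. -/
def FT (T : ℝ) : Finset ℚ :=
  ((Finset.Icc (1 : ℤ) ⌊T⌋ ×ˢ Finset.Icc (1 : ℤ) ⌊T⌋).filter
      fun w => Int.gcd w.1 w.2 = 1).image fun w => (w.1 : ℚ) / (w.2 : ℚ)

/-- Reduction of a rational number `t` modulo `p`, as `num·den⁻¹` in `ZMod p`. -/
def redQ (p : ℕ) (t : ℚ) : ZMod p := (t.num : ZMod p) * (t.den : ZMod p)⁻¹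

/-- The number of `𝔽_p`-points of the curve `Y² = X³ + AX + B`
(affine points together with the point at infinity). -/
def numPoints (p : ℕ) (A B : ZMod p) : ℕ :=
  1 + Nat.card {P : ZMod p × ZMod p // P.2 ^ 2 = P.1 ^ 3 + A * P.1 + B}

/-- The Frobenius trace `p + 1 - #E(𝔽_p)` of `Y² = X³ + AX + B` over `𝔽_p`. -/
def frobTrace (p : ℕ) (A B : ZMod p) : ℤ := (p : ℤ) + 1 - numPoints p A B

/-- `a_p(E(t))`: the Frobenius trace of the reduction modulo `p` of the curve
`E(t) : Y² = X³ + f(t)X + g(t)`. -/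
def apE (f g : Polynomial ℤ) (p : ℕ) (t : ℚ) : ℤ :=
  frobTrace p ((f.map (Int.castRingHom (ZMod p))).eval (redQ p t))
    ((g.map (Int.castRingHom (ZMod p))).eval (redQ p t))

/-- Good reduction of `E(t)` at `p`: the denominator of `t` is coprime to `p`
and `Δ(t) ≢ 0 (mod p)`. -/
def goodRed (f g : Polynomial ℤ) (p : ℕ) (t : ℚ) : Prop :=
  ¬(p ∣ t.den) ∧ ((Dpoly f g).map (Int.castRingHom (ZMod p))).eval (redQ p t) ≠ 0

/-- `π_{E(t)}(𝔄; x)`: the number of primes `p ≤ x` of good reduction for `E(t)`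
with `a_p(E(t)) = a_p`. -/
def piSeq (f g : Polynomial ℤ) (a : ℕ → ℤ) (t : ℚ) (x : ℝ) : ℕ :=
  ((Finset.Icc 1 ⌊x⌋₊).filter fun p =>
      p.Prime ∧ goodRed f g p t ∧ apE f g p t = a p).card

/-- `π_{E(t)}(K; x)` for `K = ℚ(√d)`: the number of primes `p ≤ x` of good
reduction for `E(t)` with `a_p(E(t)) ≠ 0` and `a_p(E(t))² - 4p = d·m²`. -/
def piK (f g : Polynomial ℤ) (d : ℤ) (t : ℚ) (x : ℝ) : ℕ :=
  ((Finset.Icc 1 ⌊x⌋₊).filter fun p =>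
      p.Prime ∧ goodRed f g p t ∧ apE f g p t ≠ 0 ∧
        ∃ m : ℤ, 0 < m ∧ (apE f g p t) ^ 2 - 4 * (p : ℤ) = d * m ^ 2).card

/-- The Frobenius angle `ψ_p(E(t)) ∈ [0, π]`, with `cos ψ_p = a_p/(2√p)`. -/
def psiE (f g : Polynomial ℤ) (p : ℕ) (t : ℚ) : ℝ :=
  Real.arccos ((apE f g p t : ℝ) / (2 * Real.sqrt p))

/-- `π_{E(t)}(α, β; x)`: the number of primes `p ≤ x` of good reduction for
`E(t)` with `ψ_p(E(t)) ∈ [α, β]`. -/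
def piAngle (f g : Polynomial ℤ) (α β : ℝ) (t : ℚ) (x : ℝ) : ℕ :=
  ((Finset.Icc 1 ⌊x⌋₊).filter fun p =>
      p.Prime ∧ goodRed f g p t ∧ psiE f g p t ∈ Set.Icc α β).card

/-- The Sato–Tate density `μ_ST(α, β) = (2/π) ∫_α^β sin²θ dθ`. -/
def muST (α β : ℝ) : ℝ := (2 / Real.pi) * ∫ θ in α..β, Real.sin θ ^ 2

/-- `π(x)`: the number of primes `p ≤ x`. -/
def primePi (x : ℝ) : ℕ := ((Finset.Icc 1 ⌊x⌋₊).filter Nat.Prime).card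

/-- `e_p(w) = exp(2πi w/p)`. -/
def ep (p : ℕ) (w : ZMod p) : ℂ :=
  Complex.exp (2 * (Real.pi : ℂ) * Complex.I * (w.val : ℂ) / (p : ℂ))

section IteratedLeibniz

variable {k A : Type*} [CommRing k] [CommRing A] [Algebra k A]

/-- The general Leibniz rule for the iterates of a derivation. -/
theorem Derivation.iterate_mul (d : Derivation k A A) (n : ℕ) (a b : A) :
    d^[n] (a * b) = ∑ ij ∈ antidiagonal n, n.choose ij.1 • (d^[ij.1] a * d^[ij.2] b) := by
  induction n with
  | zero => simp
  | succ n ih =>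
    rw [sum_antidiagonal_choose_succ_nsmul (M := A) (fun i j => d^[i] a * d^[j] b) n]
    simp only [Function.iterate_succ_apply', ih, map_sum, map_nsmul, Derivation.leibniz,
      smul_eq_mul, smul_add, sum_add_distrib]
    congr 1
    refine sum_congr rfl fun ij hij => ?_
    rw [mul_comm, n.choose_symm_of_eq_add (HasAntidiagonal.mem_antidiagonal.1 hij).symm]

/-- In characteristic `p`, the `p`-th iterate of a derivation is a derivation. -/
def Derivation.iterateChar (d : Derivation k A A) (p : ℕ) [Fact p.Prime] [CharP A p] :
    Derivation k A A :=
  Derivation.mk' ((d : A →ₗ[k] A) ^ p) fun a b => by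
    have hp : p.Prime := Fact.out
    rw [Module.End.pow_apply, Module.End.pow_apply, Module.End.pow_apply]
    change d^[p] (a * b) = a • d^[p] b + b • d^[p] a
    rw [d.iterate_mul, ← Finset.sum_subset (s₁ := {(0, p), (p, 0)})]
    · rw [sum_pair (by simp [hp.ne_zero.symm])]
      simp [mul_comm]
    · intro x hx
      simp only [mem_insert, mem_singleton] at hx
      rcases hx with rfl | rfl <;> simp
    · rintro ⟨i, j⟩ hij hx
      rw [HasAntidiagonal.mem_antidiagonal] at hij
      simp only [mem_insert, mem_singleton, Prod.mk.injEq, not_or, not_and] at hx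
      have h1 : p ∣ p.choose i := hp.dvd_choose_self (by grind) (by grind)
      rw [nsmul_eq_mul, (CharP.cast_eq_zero_iff A p _).2 h1, zero_mul]

theorem Derivation.iterateChar_apply (d : Derivation k A A) (p : ℕ) [Fact p.Prime] [CharP A p]
    (a : A) : d.iterateChar p a = d^[p] a := by
  change ((d : A →ₗ[k] A) ^ p) a = _
  rw [Module.End.pow_apply]
  rfl

/-- The derivation of `A[X]` acting by `d` on the coefficients. -/
def Derivation.onCoeff (d : Derivation k A A) : Derivation k A[X] A[X] :=
  Derivation.mk'
    { toFun := fun q => q.sum fun n a => monomial n (d a)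
      map_add' := fun q r => Polynomial.sum_add_index q r _ (by simp) (by simp)
      map_smul' := fun c q => by
        rw [Polynomial.sum_smul_index' _ _ _ (by simp)]
        simp only [Polynomial.sum, RingHom.id_apply, smul_sum, smul_monomial, map_smul] }
    fun q r => by
      induction q using Polynomial.induction_on' with
      | add q₁ q₂ h₁ h₂ =>
        rw [add_mul, map_add, h₁, h₂, map_add, add_smul, smul_add]; abel
      | monomial n a =>
        induction r using Polynomial.induction_on' with
        | add r₁ r₂ h₁ h₂ =>
          rw [mul_add, map_add, h₁, h₂, map_add, add_smul, smul_add]; abel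
        | monomial m b =>
          simp [monomial_mul_monomial, add_comm m n]

@[simp]
theorem Derivation.onCoeff_monomial (d : Derivation k A A) (n : ℕ) (a : A) :
    d.onCoeff (monomial n a) = monomial n (d a) := by
  change (monomial n a).sum (fun n a => monomial n (d a)) = _
  simp

@[simp]
theorem Derivation.coeff_onCoeff (d : Derivation k A A) (q : A[X]) (n : ℕ) :
    (d.onCoeff q).coeff n = d (q.coeff n) := by
  induction q using Polynomial.induction_on' with
  | add q₁ q₂ h₁ h₂ => simp [h₁, h₂]
  | monomial m a => simp [coeff_monomial, apply_ite d]

@[simp]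
theorem Derivation.onCoeff_C (d : Derivation k A A) (a : A) : d.onCoeff (C a) = C (d a) := by
  rw [← monomial_zero_left, Derivation.onCoeff_monomial, monomial_zero_left]

@[simp]
theorem Derivation.onCoeff_X (d : Derivation k A A) : d.onCoeff (X : A[X]) = 0 := by
  rw [← monomial_one_one_eq_X, Derivation.onCoeff_monomial, map_one_eq_zero, map_zero]

end IteratedLeibniz

namespace LinSys

variable {k : Type*} [Field k]

/-- The derivation `X (1 - X) d/dX` of `k[X]`. -/
def th0 : Derivation k k[X] k[X] := (X * (1 - X) : k[X]) • derivative'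

theorem th0_apply (q : k[X]) : th0 q = X * (1 - X) * derivative q := rfl

/-- The partial derivative with respect to the inner variable `Y` of `k[X][Y][Z]`. -/
def dY : Derivation k[X] k[X][X][X] k[X][X][X] :=
  (derivative' : Derivation k[X] k[X][X] k[X][X]).onCoeff

/-- The partial derivative with respect to the outer variable `Z` of `k[X][Y][Z]`. -/
def dZ : Derivation k[X] k[X][X][X] k[X][X][X] :=
  (derivative' : Derivation k[X][X] k[X][X][X] k[X][X][X]).restrictScalars k[X]

/-- The derivation of `k[X][Y][Z]` extending `th0` with `Y ↦ Z` and `Z ↦ σ Y`. -/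
def theta (σ : k[X]) : Derivation k k[X][X][X] k[X][X][X] :=
  th0.onCoeff.onCoeff + (X : k[X][X][X]) • dY.restrictScalars k +
    (C (C σ * X) : k[X][X][X]) • dZ.restrictScalars k

/-- The coefficient of `Y ^ j * Z ^ l`. -/
def cf (F : k[X][X][X]) (j l : ℕ) : k[X] := (F.coeff l).coeff j

@[ext]
theorem cf_ext {F G : k[X][X][X]} (h : ∀ j l, cf F j l = cf G j l) : F = G := by
  ext l j : 2
  exact h j l

@[simp] theorem cf_zero (j l : ℕ) : cf (0 : k[X][X][X]) j l = 0 := by simp [cf]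

@[simp] theorem cf_add (F G : k[X][X][X]) (j l : ℕ) : cf (F + G) j l = cf F j l + cf G j l := by
  simp [cf]

@[simp] theorem cf_sub (F G : k[X][X][X]) (j l : ℕ) : cf (F - G) j l = cf F j l - cf G j l := by
  simp [cf]

@[simp] theorem cf_smul (r : k[X]) (F : k[X][X][X]) (j l : ℕ) : cf (r • F) j l = r * cf F j l := by
  simp [cf]

theorem smul_eq_C (r : k[X]) (F : k[X][X][X]) : r • F = C (C r) * F := by
  ext j l : 2
  simp [cf, coeff_C_mul]

theorem cf_X_mul (F : k[X][X][X]) (j l : ℕ) :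
    cf (X * F) j l = if l = 0 then 0 else cf F j (l - 1) := by
  rcases l with _ | l <;> simp [cf, coeff_X_mul]

theorem cf_Y_mul (F : k[X][X][X]) (j l : ℕ) :
    cf (C X * F) j l = if j = 0 then 0 else cf F (j - 1) l := by
  rcases j with _ | j <;> simp [cf, coeff_C_mul, coeff_X_mul]

theorem cf_dY (F : k[X][X][X]) (j l : ℕ) : cf (dY F) j l = (j + 1) * cf F (j + 1) l := by
  simp [cf, dY, coeff_derivative, mul_comm]

theorem cf_dZ (F : k[X][X][X]) (j l : ℕ) : cf (dZ F) j l = (l + 1) * cf F j (l + 1) := by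
  have h : dZ F = derivative F := rfl
  rw [h, cf, coeff_derivative]
  have : ((l : k[X][X]) + 1) = C ((l : k[X]) + 1) := by simp
  rw [this, mul_comm, coeff_C_mul]
  rfl

theorem theta_apply (σ : k[X]) (F : k[X][X][X]) :
    theta σ F = th0.onCoeff.onCoeff F + X * dY F + σ • (C X * dZ F) := by
  rw [smul_eq_C, ← mul_assoc, ← C_mul]
  rfl

theorem cf_onCoeff (F : k[X][X][X]) (j l : ℕ) :
    cf (th0.onCoeff.onCoeff F) j l = th0 (cf F j l) := by
  simp [cf]

theorem cf_theta (σ : k[X]) (F : k[X][X][X]) (j l : ℕ) :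
    cf (theta σ F) j l = th0 (cf F j l) + (if l = 0 then 0 else (j + 1) * cf F (j + 1) (l - 1)) +
      σ * (if j = 0 then 0 else (l + 1) * cf F (j - 1) (l + 1)) := by
  rw [theta_apply, cf_add, cf_add, cf_onCoeff, cf_X_mul, cf_smul, cf_Y_mul, cf_dY, cf_dZ]

/-- The polynomials all of whose monomials have total degree in `R` with respect to `Y, Z`. -/
def VR (R : Finset ℕ) : Submodule k[X] k[X][X][X] where
  carrier := {F | ∀ j l, j + l ∉ R → cf F j l = 0}
  add_mem' hF hG j l h := by rw [cf_add, hF j l h, hG j l h, add_zero]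
  zero_mem' j l _ := cf_zero j l
  smul_mem' r F hF j l h := by rw [cf_smul, hF j l h, mul_zero]

variable {R : Finset ℕ} {σ : k[X]} {F : k[X][X][X]}

theorem ZdY_mem (hF : F ∈ VR R) : X * dY F ∈ VR R := fun j l h => by
  rw [cf_X_mul, cf_dY]
  split_ifs with h0
  · rfl
  · rw [hF _ _ (by rwa [show j + 1 + (l - 1) = j + l by omega]), mul_zero]

theorem YdZ_mem (hF : F ∈ VR R) : C X * dZ F ∈ VR R := fun j l h => by
  rw [cf_Y_mul, cf_dZ]
  split_ifs with h0
  · rfl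
  · rw [hF _ _ (by rwa [show j - 1 + (l + 1) = j + l by omega]), mul_zero]

theorem theta_mem (hF : F ∈ VR R) : theta σ F ∈ VR R := by
  rw [theta_apply]
  refine add_mem (add_mem (fun j l h => ?_) (ZdY_mem hF)) ((VR R).smul_mem _ (YdZ_mem hF))
  rw [cf_onCoeff, hF j l h, map_zero]

theorem iterate_theta_mem (hF : F ∈ VR R) (n : ℕ) : (theta σ)^[n] F ∈ VR R := by
  induction n with
  | zero => exact hF
  | succ n ih => rw [Function.iterate_succ_apply']; exact theta_mem ih

theorem natDegree_th0_le (q : k[X]) : (th0 q).natDegree ≤ q.natDegree + 1 := by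
  rw [th0_apply]
  have h1 := natDegree_derivative_le q
  have h3 : (X * (1 - X) : k[X]).natDegree ≤ 2 := by compute_degree
  rcases Nat.eq_zero_or_pos q.natDegree with h0 | h0
  · rw [eq_C_of_natDegree_eq_zero h0]; simp
  · exact natDegree_mul_le.trans (by omega)

theorem natDegree_natCast_succ_mul_le (j : ℕ) (q : k[X]) :
    (((j : k[X]) + 1) * q).natDegree ≤ q.natDegree := by
  have : (j : k[X]) + 1 = C ((j : k) + 1) := by simp
  rw [this]
  exact natDegree_C_mul_le _ _

theorem natDegree_cf_ite_le {d : ℕ} (hF : ∀ j l, (cf F j l).natDegree ≤ d) (P : Prop) [Decidable P]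
    (m j l : ℕ) :
    (if P then 0 else ((m : k[X]) + 1) * cf F j l).natDegree ≤ d := by
  split_ifs
  · simp
  · exact (natDegree_natCast_succ_mul_le _ _).trans (hF _ _)

theorem natDegree_cf_YdZ_le {d : ℕ} (hF : ∀ j l, (cf F j l).natDegree ≤ d) (j l : ℕ) :
    (cf (C X * dZ F) j l).natDegree ≤ d := by
  rw [cf_Y_mul, cf_dZ]
  exact natDegree_cf_ite_le hF _ _ _ _

theorem natDegree_cf_theta_le (hσ : σ.natDegree ≤ 2) {d : ℕ}
    (hF : ∀ j l, (cf F j l).natDegree ≤ d) (j l : ℕ) :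
    (cf (theta σ F) j l).natDegree ≤ d + 2 := by
  rw [cf_theta]
  refine natDegree_add_le_of_degree_le (natDegree_add_le_of_degree_le ?_ ?_) ?_
  · exact (natDegree_th0_le _).trans (by have := hF j l; omega)
  · exact (natDegree_cf_ite_le hF _ _ _ _).trans (by omega)
  · refine natDegree_mul_le.trans ?_
    have := natDegree_cf_ite_le hF (j = 0) l (j - 1) (l + 1)
    omega

theorem natDegree_cf_iterate_theta_le (hσ : σ.natDegree ≤ 2) {d : ℕ}
    (hF : ∀ j l, (cf F j l).natDegree ≤ d) (n j l : ℕ) :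
    (cf ((theta σ)^[n] F) j l).natDegree ≤ d + 2 * n := by
  induction n generalizing j l with
  | zero => exact hF j l
  | succ n ih =>
    rw [Function.iterate_succ_apply']
    exact (natDegree_cf_theta_le hσ ih j l).trans (by omega)

/-- Evaluation at `Y = H`, `Z = H₁`. -/
def ev (H H₁ : k[X]) : k[X][X][X] →ₐ[k[X]] k[X] :=
  (aeval H).comp ((aeval (C H₁ : k[X][X])).restrictScalars k[X])

@[simp] theorem ev_Z (H H₁ : k[X]) : ev H H₁ X = H₁ := by simp [ev]
@[simp] theorem ev_Y (H H₁ : k[X]) : ev H H₁ (C X) = H := by simp [ev]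
@[simp] theorem ev_C (H H₁ r : k[X]) : ev H H₁ (C (C r)) = r := by
  have := (ev H H₁).commutes r
  simpa using this

theorem theta_C (r : k[X]) : theta σ (C (C r)) = C (C (th0 r)) := by
  rw [theta_apply]
  simp [dY, dZ, derivative']

theorem theta_Y : theta σ (C X) = X := by
  rw [theta_apply]
  simp [dY, dZ, derivative']

theorem theta_Z : theta σ X = C (C σ * X) := by
  rw [theta_apply, smul_eq_C]
  simp [dY, dZ, derivative']

/-- Induction principle for `k[X][Y][Z]`. -/
theorem poly_induction {P : k[X][X][X] → Prop} (hC : ∀ r, P (C (C r))) (hY : P (C X)) (hZ : P X)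
    (hadd : ∀ F G, P F → P G → P (F + G)) (hmul : ∀ F G, P F → P G → P (F * G)) (F : k[X][X][X]) :
    P F := by
  have hpow : ∀ F : k[X][X][X], P F → ∀ n : ℕ, P (F ^ n) := fun F hF n => by
    induction n with
    | zero => simpa using hC 1
    | succ n ih => rw [pow_succ]; exact hmul _ _ ih hF
  induction F using Polynomial.induction_on' with
  | add F G hF hG => exact hadd _ _ hF hG
  | monomial l a =>
    rw [← C_mul_X_pow_eq_monomial]
    refine hmul _ _ ?_ (hpow _ hZ l)
    induction a using Polynomial.induction_on' with
    | add a b ha hb => rw [C_add]; exact hadd _ _ ha hb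
    | monomial j r =>
      rw [← C_mul_X_pow_eq_monomial, C_mul, C_pow]
      exact hmul _ _ (hC r) (hpow _ hY j)

theorem th0_ev {H H₁ : k[X]} (h1 : th0 H = H₁) (h2 : th0 H₁ = σ * H) (F : k[X][X][X]) :
    th0 (ev H H₁ F) = ev H H₁ (theta σ F) := by
  induction F using poly_induction with
  | hC r => simp [theta_C]
  | hY => simp [theta_Y, h1]
  | hZ => simp only [theta_Z, ev_Z, h2, map_mul, ev_C, ev_Y]
  | hadd F G hF hG => simp [hF, hG]
  | hmul F G hF hG => simp [hF, hG]

theorem derivation_eq (D : Derivation k[X] k[X][X][X] k[X][X][X]) (F : k[X][X][X]) :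
    D F = dY F * D (C X) + dZ F * D X := by
  induction F using poly_induction with
  | hC r =>
    have h : (C (C r) : k[X][X][X]) = algebraMap k[X] _ r := rfl
    rw [h, D.map_algebraMap, dY.map_algebraMap, dZ.map_algebraMap]; ring
  | hY => simp [dY, dZ, derivative']
  | hZ => simp [dY, dZ, derivative']
  | hadd F G hF hG => rw [map_add, map_add, map_add, hF, hG]; ring
  | hmul F G hF hG =>
    simp only [Derivation.leibniz, hF, hG, smul_eq_mul]; ring

end LinSys

namespace LinSys

variable {k : Type*} [Field k] {p : ℕ} [Fact p.Prime] [CharP k p]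

variable {R : Finset ℕ} {σ : k[X]} {F : k[X][X][X]}

theorem derivation_apply_eq (E : Derivation k k[X] k[X]) (q : k[X]) :
    E q = derivative q * E X := by
  have h : E = mkDerivation k (E X) := by ext; simp
  conv_lhs => rw [h]
  rw [mkDerivation_apply, smul_eq_mul]

include p in
theorem th0_iterate_char (q : k[X]) : th0^[p] q = th0 q := by
  have hp : p.Prime := Fact.out
  set E : Derivation k k[X] k[X] := th0.iterateChar p - th0 with hE
  have hEapp : ∀ q, E q = th0^[p] q - th0 q := fun q => by
    rw [hE, Derivation.sub_apply, Derivation.iterateChar_apply]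
  set u : k[X] := X * (1 - X) ^ (p - 1) with hu
  have hcast : ((p - 1 : ℕ) : k[X]) = -1 := by
    rw [Nat.cast_sub hp.one_le, CharP.cast_eq_zero]; simp
  have hthu : th0 u = u := by
    obtain ⟨m, hm⟩ : ∃ m, p - 1 = m + 1 := ⟨p - 2, by have := hp.two_le; omega⟩
    rw [hm] at hcast
    rw [th0_apply, hu, hm]
    simp only [derivative_mul, derivative_X, derivative_pow, derivative_sub, derivative_one,
      add_tsub_cancel_right, map_natCast]
    rw [hcast]
    ring
  have hu0 : u ≠ 0 := by
    refine mul_ne_zero X_ne_zero (pow_ne_zero _ fun h => ?_)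
    simpa using congrArg (eval 0) h
  have hit : ∀ n, th0^[n] u = u := fun n => by
    induction n with
    | zero => rfl
    | succ n ih => rw [Function.iterate_succ_apply', ih, hthu]
  have h1 : E u = 0 := by rw [hEapp, hit, hthu, sub_self]
  rw [derivation_apply_eq] at h1
  have h2 : derivative u ≠ 0 := fun h => hu0 (by rw [← hthu, th0_apply, h, mul_zero])
  have h3 : E X = 0 := (mul_eq_zero.1 h1).resolve_left h2
  have h4 : E q = 0 := by rw [derivation_apply_eq, h3, mul_zero]
  rw [hEapp] at h4
  exact sub_eq_zero.1 h4

theorem theta_smul (r : k[X]) (F : k[X][X][X]) :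
    theta σ (r • F) = th0 r • F + r • theta σ F := by
  simp only [smul_eq_C, Derivation.leibniz, theta_C, smul_eq_mul]
  ring

theorem theta_sub (F G : k[X][X][X]) : theta σ (F - G) = theta σ F - theta σ G :=
  map_sub (theta σ) F G

theorem VR_sub_mem {G : k[X][X][X]} (hF : F ∈ VR R) (hG : G ∈ VR R) : F - G ∈ VR R :=
  fun j l h => by rw [cf_sub, hF j l h, hG j l h, sub_zero]

theorem theta_iterate_C (r : k[X]) (n : ℕ) :
    (theta σ)^[n] (C (C r)) = C (C (th0^[n] r)) := by
  induction n with
  | zero => rfl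
  | succ n ih => rw [Function.iterate_succ_apply', Function.iterate_succ_apply', ih, theta_C]

/-- The `p`-curvature of the system: the `k[X]`-linear derivation `θ ^ p - θ`. -/
def curv (σ : k[X]) (p : ℕ) [Fact p.Prime] [CharP k p] :
    Derivation k[X] k[X][X][X] k[X][X][X] :=
  Derivation.mk'
    { toFun := fun F => (theta σ).iterateChar (k := k) (A := k[X][X][X]) p F - theta σ F
      map_add' := fun F G => by rw [map_add, map_add]; ring
      map_smul' := fun r F => by
        have hr : (theta σ).iterateChar (k := k) (A := k[X][X][X]) p (C (C r)) =
            theta σ (C (C r)) := by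
          rw [Derivation.iterateChar_apply, theta_iterate_C, th0_iterate_char (p := p), theta_C]
        rw [smul_eq_C, Derivation.leibniz, Derivation.leibniz, hr, RingHom.id_apply, smul_eq_mul,
          smul_eq_mul, smul_eq_C]
        ring }
    (fun F G => by
      change (theta σ).iterateChar (k := k) (A := k[X][X][X]) p (F * G) - theta σ (F * G) =
        F * ((theta σ).iterateChar (k := k) (A := k[X][X][X]) p G - theta σ G) +
        G * ((theta σ).iterateChar (k := k) (A := k[X][X][X]) p F - theta σ F)
      rw [Derivation.leibniz, Derivation.leibniz, smul_eq_mul, smul_eq_mul, smul_eq_mul,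
        smul_eq_mul]
      ring)

theorem curv_apply (F : k[X][X][X]) : curv σ p F = (theta σ)^[p] F - theta σ F := by
  change (theta σ).iterateChar (k := k) (A := k[X][X][X]) p F - theta σ F = _
  rw [Derivation.iterateChar_apply]

theorem ev_iterate_theta {H H₁ : k[X]} (h1 : th0 H = H₁) (h2 : th0 H₁ = σ * H) (F : k[X][X][X])
    (n : ℕ) : ev H H₁ ((theta σ)^[n] F) = th0^[n] (ev H H₁ F) := by
  induction n with
  | zero => rfl
  | succ n ih => rw [Function.iterate_succ_apply', Function.iterate_succ_apply', ← ih, th0_ev h1 h2]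

theorem cf_Z (j l : ℕ) : cf (X : k[X][X][X]) j l = if j = 0 ∧ l = 1 then 1 else 0 := by
  simp only [cf, coeff_X]
  split_ifs <;> simp_all [coeff_one]

theorem cf_Y (j l : ℕ) : cf (C X : k[X][X][X]) j l = if j = 1 ∧ l = 0 then 1 else 0 := by
  simp only [cf, coeff_C]
  split_ifs <;> simp_all [coeff_X, eq_comm]

theorem Y_mem : (C X : k[X][X][X]) ∈ VR {1} := fun j l h => by
  rw [cf_Y, if_neg]; rintro ⟨rfl, rfl⟩; simp at h

theorem eval_th0_zero (q : k[X]) : (th0 q).eval 0 = 0 := by simp [th0_apply]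

theorem eval_cf_iterate_theta_Y (hσ : σ.eval 0 = 0) (n : ℕ) :
    (cf ((theta σ)^[n + 2] (C X)) 0 1).eval 0 = 0 ∧
      (cf ((theta σ)^[n + 2] (C X)) 1 0).eval 0 = 0 := by
  have h : ∀ F : k[X][X][X], (cf F 1 0).eval 0 = 0 → (cf (theta σ F) 0 1).eval 0 = 0 ∧
      (cf (theta σ F) 1 0).eval 0 = 0 := fun F hF => by
    simp [cf_theta, eval_th0_zero, hF, hσ]
  induction n with
  | zero =>
    simp only [Function.iterate_succ_apply', Function.iterate_zero, id, theta_Y, zero_add]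
    exact h _ (by simp [cf_Z])
  | succ n ih =>
    rw [show n + 1 + 2 = (n + 2) + 1 by ring, Function.iterate_succ_apply']
    exact h _ ih.2

theorem curv_identity {A : Type*} [CommRing A] {a b h h₁ y z u v n : A} (h1 : a * h + b * h₁ = 0)
    (h2 : h₁ * (a * y + b * z) = h * n) : h ^ 2 * (u * (a * y + b * z) + v * n) =
      -b * (h * h₁ * (y * u - z * v) + h₁ ^ 2 * (y * v) - h ^ 2 * (z * u)) := by
  linear_combination (u * h * y + v * h₁ * y) * h1 - v * h * h2

theorem exists_curv_eq (hσ : σ.eval 0 = 0) {H H₁ : k[X]} (h1 : th0 H = H₁)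
    (h2 : th0 H₁ = σ * H) : ∃ β : k[X], β ≠ 0 ∧ ∀ F, (H ^ 2) • curv σ p F =
      (-β) • ((H * H₁) • (C X * dY F - X * dZ F) + (H₁ ^ 2) • (C X * dZ F) -
        (H ^ 2) • (X * dY F)) := by
  have hp : p.Prime := Fact.out
  set α := cf (curv σ p (C X)) 1 0 with hα
  set β := cf (curv σ p (C X)) 0 1 with hβ
  have hmem : curv σ p (C X) ∈ VR {1} := by
    rw [curv_apply]
    exact VR_sub_mem (iterate_theta_mem Y_mem p) (theta_mem Y_mem)
  have hNY : curv σ p (C X) = C (C α) * C X + C (C β) * X := by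
    ext j l : 1
    rw [← smul_eq_C, ← smul_eq_C, cf_add, cf_smul, cf_smul, cf_Y, cf_Z]
    by_cases hjl : j + l ∈ ({1} : Finset ℕ)
    · have : (j = 0 ∧ l = 1) ∨ (j = 1 ∧ l = 0) := by simp at hjl; omega
      rcases this with ⟨rfl, rfl⟩ | ⟨rfl, rfl⟩ <;> simp [hα, hβ]
    · rw [hmem j l hjl, if_neg, if_neg] <;> [simp; skip; skip] <;>
      · rintro ⟨rfl, rfl⟩; simp at hjl
  have hβ0 : β ≠ 0 := fun h => by
    obtain ⟨n, hn⟩ : ∃ n, p = n + 2 := ⟨p - 2, by have := hp.two_le; omega⟩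
    have h3 := (eval_cf_iterate_theta_Y hσ n).1
    rw [← hn] at h3
    rw [hβ, curv_apply, theta_Y, cf_sub] at h
    have h4 := congrArg (eval 0) h
    rw [eval_sub, h3] at h4
    simp [cf_Z] at h4
  have hev : α * H + β * H₁ = 0 := by
    have h3 : ev H H₁ (curv σ p (C X)) = 0 := by
      rw [curv_apply, map_sub (ev H H₁), ev_iterate_theta h1 h2, ← th0_ev h1 h2, th0_iterate_char,
        sub_self]
    simpa [hNY] using h3
  have hl : theta σ (H₁ • (C X) - H • X) = 0 := by
    rw [theta_sub, theta_smul, theta_smul, theta_Y, theta_Z, h1, h2]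
    simp only [smul_eq_C, C_mul]; ring
  have hNl : H₁ • curv σ p (C X) = H • curv σ p X := by
    rw [← sub_eq_zero, ← Derivation.map_smul, ← Derivation.map_smul, ← map_sub (curv σ p),
      curv_apply, hl]
    obtain ⟨n, hn⟩ : ∃ n, p = n + 1 := ⟨p - 1, by have := hp.two_le; omega⟩
    rw [hn, Function.iterate_succ_apply, hl, Function.iterate_fixed (map_zero _) n]
    ring
  refine ⟨β, hβ0, fun F => ?_⟩
  rw [derivation_eq (curv σ p) F]
  simp only [smul_eq_C] at hNl ⊢
  have hev' : (C (C α) * C (C H) + C (C β) * C (C H₁) : k[X][X][X]) = 0 := by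
    simp only [← C_mul, ← C_add, hev, C_0]
  simp only [C_mul, C_pow, C_neg]
  rw [hNY] at hNl ⊢
  exact curv_identity (A := k[X][X][X]) hev' hNl

end LinSys

section Cramer

variable {A I : Type*} [CommRing A] {n : ℕ}

theorem exists_det_ne_zero [IsDomain A] [Fintype I] (G : Fin n → I → A)
    (hG : LinearIndependent A G) :
    ∃ P : Fin n → I, (Matrix.of fun i j => G i (P j)).det ≠ 0 := by
  let K := FractionRing A
  let φ : (I → A) →ₗ[A] (I → K) := (Algebra.linearMap A K).compLeft I
  have hφ : Function.Injective φ := fun a b h => by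
    ext c
    exact IsFractionRing.injective A K (congrFun h c)
  have h1 : LinearIndependent K (fun i => φ (G i)) := by
    rw [← LinearIndependent.iff_fractionRing A K]
    exact hG.map' φ (LinearMap.ker_eq_bot.2 hφ)
  let M : Matrix (Fin n) I K := Matrix.of fun i => φ (G i)
  have h2 : M.rank = n := by
    have := LinearIndependent.rank_matrix (M := M) h1
    simpa using this
  rw [Matrix.rank_eq_finrank_span_cols] at h2
  obtain ⟨f, hf, -, hli⟩ := Submodule.exists_fun_fin_finrank_span_eq K (Set.range M.col)
  choose P hP using hf
  refine ⟨fun j => P (Fin.cast h2.symm j), fun h => ?_⟩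
  have h3 : LinearIndependent K (fun j => f (Fin.cast h2.symm j)) :=
    hli.comp _ (Fin.cast_injective _)
  let N : Matrix (Fin n) (Fin n) K := Matrix.of fun i j => φ (G i) (P (Fin.cast h2.symm j))
  have h4 : N.col = fun j => f (Fin.cast h2.symm j) := by
    ext j i
    rw [← hP]; rfl
  have h5 : IsUnit N := Matrix.linearIndependent_cols_iff_isUnit.1 (h4 ▸ h3)
  have h6 : N = (algebraMap A K).mapMatrix (Matrix.of fun i j => G i (P (Fin.cast h2.symm j))) := by
    ext i j; rfl
  rw [Matrix.isUnit_iff_isUnit_det, h6, ← RingHom.map_det, h, map_zero] at h5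
  exact not_isUnit_zero h5

/-- The linear map `v ↦ det(M) v - ∑ᵢ cᵢ(v) Gᵢ`, where `M` is the square matrix formed by the
columns `P` of `G` and the `cᵢ` are given by Cramer's rule. -/
def cramerMap (G : Fin n → I → A) (P : Fin n → I) : (I → A) →ₗ[A] (I → A) where
  toFun v c := (Matrix.of fun i j => G i (P j)).det * v c -
    ∑ i, Matrix.vecMul (fun j => v (P j)) (Matrix.of fun i j => G i (P j)).adjugate i * G i c
  map_add' v w := by
    ext c
    have : (fun j => (v + w) (P j)) = (fun j => v (P j)) + fun j => w (P j) := rfl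
    rw [this, Matrix.add_vecMul]
    simp only [Pi.add_apply, add_mul, mul_add, sum_add_distrib]
    ring
  map_smul' r v := by
    ext c
    have : (fun j => (r • v) (P j)) = r • (fun j => v (P j)) := rfl
    rw [this, Matrix.smul_vecMul]
    simp only [Pi.smul_apply, smul_eq_mul, RingHom.id_apply, mul_sub, mul_sum, mul_assoc]
    ring

theorem cramerMap_apply (G : Fin n → I → A) (P : Fin n → I) (v : I → A) (c : I) :
    cramerMap G P v c = (Matrix.of fun i j => G i (P j)).det * v c -
      ∑ i, Matrix.vecMul (fun j => v (P j)) (Matrix.of fun i j => G i (P j)).adjugate i * G i c :=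
  rfl

theorem cramerMap_self (G : Fin n → I → A) (P : Fin n → I) (i : Fin n) :
    cramerMap G P (G i) = 0 := by
  ext c
  have h : Matrix.vecMul (fun j => G i (P j)) (Matrix.of fun i j => G i (P j)).adjugate =
      Pi.single i (Matrix.of fun i j => G i (P j)).det := by
    have h1 := congrFun (Matrix.mul_adjugate (Matrix.of fun i j => G i (P j))) i
    rw [Matrix.mul_apply_eq_vecMul] at h1
    rw [show (fun j => G i (P j)) = (Matrix.of fun i j => G i (P j)) i from rfl, h1]
    ext j
    simp [Matrix.one_apply, Pi.single_apply, eq_comm]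
  rw [cramerMap_apply, h]
  simp [Pi.single_apply]

theorem cramerMap_eq_zero {G : Fin n → I → A} {P : Fin n → I} {v : I → A}
    (h : cramerMap G P v = 0) :
    ∃ c : Fin n → A, (Matrix.of fun i j => G i (P j)).det • v = ∑ i, c i • G i := by
  refine ⟨Matrix.vecMul (fun j => v (P j)) (Matrix.of fun i j => G i (P j)).adjugate, ?_⟩
  ext c
  rw [Finset.sum_apply]
  exact sub_eq_zero.1 ((cramerMap_apply G P v c).symm.trans (congrFun h c))

theorem natDegree_det_le_sum {k ι : Type*} [CommRing k] [Fintype ι] [DecidableEq ι]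
    (M : Matrix ι ι k[X]) (e : ι → ℕ) (h : ∀ i j, (M i j).natDegree ≤ e i) :
    M.det.natDegree ≤ ∑ i, e i := by
  rw [Matrix.det_apply]
  refine natDegree_sum_le_of_forall_le _ _ fun s _ => ?_
  refine (natDegree_smul_le _ _).trans ((natDegree_prod_le _ _).trans ?_)
  rw [← Equiv.sum_comp s e]
  exact sum_le_sum fun i _ => h _ _

theorem natDegree_cramerMap_le {k : Type*} [CommRing k] {G : Fin n → I → k[X]} {P : Fin n → I}
    {d e : ℕ} (hG : ∀ i c, (G i c).natDegree ≤ d) {v : I → k[X]} (hv : ∀ c, (v c).natDegree ≤ e)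
    (c : I) : (cramerMap G P v c).natDegree ≤ n * d + e := by
  rw [cramerMap_apply]
  refine (natDegree_sub_le _ _).trans (max_le ?_ ?_)
  · refine natDegree_mul_le_of_le ?_ (hv c)
    exact (natDegree_det_le_sum _ (fun _ => d) fun i j => hG _ _).trans (by simp)
  · refine natDegree_sum_le_of_forall_le _ _ fun i _ => ?_
    obtain ⟨n, rfl⟩ : ∃ m, n = m + 1 := ⟨n - 1, by have := i.pos; omega⟩
    have h1 : (n + 1) * d + e = (e + n * d) + d := by ring
    rw [h1]
    refine natDegree_mul_le_of_le ?_ (hG i c)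
    rw [Matrix.vecMul, dotProduct]
    refine natDegree_sum_le_of_forall_le _ _ fun j _ => ?_
    refine natDegree_mul_le_of_le (hv _) ?_
    rw [Matrix.adjugate_apply]
    refine (natDegree_det_le_sum _ (fun l => if l = i then 0 else d) fun l m => ?_).trans ?_
    · rw [Matrix.updateRow_apply]
      split_ifs with h
      · rw [Pi.single_apply]; split_ifs <;> simp
      · exact hG _ _
    · rw [sum_ite]; simp [filter_ne', card_erase_of_mem]

end Cramer

namespace LinSys

variable {k : Type*} [Field k]

/-- The exponents `(j, l)` of the monomials `Y ^ j * Z ^ l` of total degree in `R`. -/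
def mons (R : Finset ℕ) : Finset (ℕ × ℕ) := R.biUnion antidiagonal

theorem mem_mons {R : Finset ℕ} {c : ℕ × ℕ} : c ∈ mons R ↔ c.1 + c.2 ∈ R := by
  simp [mons]

theorem card_mons (R : Finset ℕ) : (mons R).card = ∑ r ∈ R, (r + 1) := by
  rw [mons, card_biUnion]
  · simp
  · intro r _ s _ hrs
    rw [Function.onFun, disjoint_left]
    rintro ⟨a, b⟩ h1 h2
    rw [HasAntidiagonal.mem_antidiagonal] at h1 h2
    exact hrs (h1.symm.trans h2)

/-- The vector of coefficients of a polynomial with respect to the monomials in `mons R`. -/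
def vec (R : Finset ℕ) : k[X][X][X] →ₗ[k[X]] (mons R → k[X]) where
  toFun F c := cf F c.1.1 c.1.2
  map_add' F G := by ext1 c; exact cf_add F G _ _
  map_smul' r F := by ext1 c; exact cf_smul r F _ _

variable {R : Finset ℕ} {σ : k[X]} {F G : k[X][X][X]}

theorem vec_apply (F : k[X][X][X]) (c : mons R) : vec R F c = cf F c.1.1 c.1.2 := rfl

theorem vec_inj (hF : F ∈ VR R) (hG : G ∈ VR R) (h : vec R F = vec R G) : F = G := by
  refine cf_ext fun j l => ?_
  by_cases hc : j + l ∈ R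
  · exact congrFun h ⟨(j, l), mem_mons.2 hc⟩
  · rw [hF j l hc, hG j l hc]

theorem exists_cramer_data (hσ : σ.natDegree ≤ 2) {A : ℕ}
    (hA : ∀ j l, (cf F j l).natDegree ≤ A) :
    ∃ n ≤ (mons R).card, ∃ (D : k[X]) (Φ : (mons R → k[X]) →ₗ[k[X]] (mons R → k[X])),
      D ≠ 0 ∧ D.natDegree ≤ n * (A + 2 * n) ∧ (∀ i ≤ n, Φ (vec R ((theta σ)^[i] F)) = 0) ∧
      (∀ v, Φ v = 0 → ∃ c : Fin n → k[X], D • v = ∑ i, c i • vec R ((theta σ)^[i] F)) ∧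
      ∀ (e : ℕ) (v : mons R → k[X]), (∀ c, (v c).natDegree ≤ e) →
        ∀ c, (Φ v c).natDegree ≤ n * (A + 2 * n) + e := by
  let g : ℕ → mons R → k[X] := fun i => vec R ((theta σ)^[i] F)
  have hex : ∃ N, ¬LinearIndependent k[X] (fun i : Fin N => g i) := by
    refine ⟨(mons R).card + 1, fun h => ?_⟩
    have := h.fintype_card_le_finrank
    simp at this
  let N := Nat.find hex
  have hN : ¬LinearIndependent k[X] (fun i : Fin N => g i) := Nat.find_spec hex
  have hmin : ∀ m < N, LinearIndependent k[X] (fun i : Fin m => g i) := fun m hm =>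
    not_not.1 (Nat.find_min hex hm)
  obtain ⟨n, hn⟩ : ∃ n, N = n + 1 := by
    refine ⟨N - 1, ?_⟩
    have : N ≠ 0 := fun h => hN (by rw [h]; exact linearIndependent_empty_type)
    omega
  have hli : LinearIndependent k[X] (fun i : Fin n => g i) := hmin n (by omega)
  obtain ⟨P, hP⟩ := exists_det_ne_zero _ hli
  have hcard : n ≤ (mons R).card := by
    have := hli.fintype_card_le_finrank
    simpa using this
  have hdeg : ∀ (i : Fin n) c, (g i c).natDegree ≤ A + 2 * n := fun i c =>
    (natDegree_cf_iterate_theta_le hσ hA i _ _).trans (by have := i.2; omega)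
  refine ⟨n, hcard, _, cramerMap (fun i : Fin n => g i) P, hP, ?_, ?_,
    fun v hv => cramerMap_eq_zero hv,
    fun e v hv c => natDegree_cramerMap_le hdeg hv c⟩
  · exact (natDegree_det_le_sum _ (fun _ => A + 2 * n) fun i j => hdeg _ _).trans (by simp)
  · intro i hi
    rcases hi.lt_or_eq with hi | rfl
    · exact cramerMap_self (fun i : Fin n => g i) P ⟨i, hi⟩
    · rw [hn, Fintype.not_linearIndependent_iff] at hN
      obtain ⟨c, hc, j, hj⟩ := hN
      rw [Fin.sum_univ_castSucc] at hc
      have hlast : c (Fin.last i) ≠ 0 := fun h => by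
        rw [h, zero_smul, add_zero] at hc
        have h2 := Fintype.linearIndependent_iff.1 hli (fun m => c m.castSucc) hc
        rcases Fin.eq_castSucc_or_eq_last j with ⟨m, rfl⟩ | rfl
        · exact hj (h2 m)
        · exact hj h
      have h3 := congrArg (cramerMap (fun m : Fin i => g m) P) hc
      rw [map_add, map_sum, map_zero, map_smul, sum_eq_zero, zero_add] at h3
      · exact (smul_eq_zero.1 h3).resolve_left hlast
      · intro m _
        rw [map_smul]
        exact (congrArg _ (cramerMap_self (fun m : Fin i => g m) P m)).trans (smul_zero _)

end LinSys

namespace LinSys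

variable {k : Type*} [Field k] {p : ℕ} [CharP k p]
variable {R : Finset ℕ} {F : k[X][X][X]}

omit [CharP k p] in
theorem cf_Y_pow (r j l : ℕ) :
    cf (C X ^ r : k[X][X][X]) j l = if j = r ∧ l = 0 then 1 else 0 := by
  rw [← C_pow]
  simp only [cf, coeff_C]
  split_ifs <;> simp_all [coeff_X_pow]

theorem natCast_ne_zero_of_lt {n : ℕ} (h0 : n ≠ 0) (hn : n < p) : (n : k) ≠ 0 := fun h =>
  h0 (Nat.eq_zero_of_dvd_of_lt ((CharP.cast_eq_zero_iff k p n).1 h) hn)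

include p in
/-- A nonzero submodule stable under `Y∂_Z` contains a nonzero polynomial free of `Z`. -/
theorem exists_mem_free_of_Z {W : Submodule k[X] k[X][X][X]} (hW : W ≤ VR R)
    (hR : ∀ r ∈ R, r < p) (hf : ∀ w ∈ W, C X * dZ w ∈ W) (hF : F ∈ W) (hF0 : F ≠ 0) :
    ∃ w ∈ W, w ≠ 0 ∧ ∀ j l, l ≠ 0 → cf w j l = 0 := by
  suffices H : ∀ (N : ℕ) (w : k[X][X][X]), w ∈ W → w ≠ 0 → (∀ j l, N < l → cf w j l = 0) →
      ∃ w ∈ W, w ≠ 0 ∧ ∀ j l, l ≠ 0 → cf w j l = 0 by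
    refine H F.natDegree F hF hF0 fun j l hl => ?_
    rw [cf, coeff_eq_zero_of_natDegree_lt hl, coeff_zero]
  intro N
  induction N with
  | zero => exact fun w hw hw0 h => ⟨w, hw, hw0, fun j l hl => h j l (by omega)⟩
  | succ N ih =>
    intro w hw hw0 h
    by_cases hz : C X * dZ w = 0
    · refine ⟨w, hw, hw0, fun j l hl => ?_⟩
      by_cases hjl : j + l ∈ R
      · have h1 : cf (C X * dZ w) (j + 1) (l - 1) = 0 := by rw [hz, cf_zero]
        obtain ⟨l, rfl⟩ : ∃ m, l = m + 1 := ⟨l - 1, by omega⟩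
        rw [cf_Y_mul, if_neg (by omega), cf_dZ, Nat.add_sub_cancel, Nat.add_sub_cancel] at h1
        refine (mul_eq_zero.1 h1).resolve_left ?_
        have h2 := natCast_ne_zero_of_lt (k := k) (p := p) hl (by have := hR _ hjl; omega)
        have h3 : ((l : k[X]) + 1) = C ((l + 1 : ℕ) : k) := by simp
        rw [h3]
        exact C_ne_zero.2 h2
      · exact hW hw j l hjl
    · refine ih _ (hf w hw) hz fun j l hl => ?_
      rw [cf_Y_mul]
      split_ifs
      · rfl
      · rw [cf_dZ, h _ _ (by omega), mul_zero]

include p in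
/-- A nonzero submodule stable under `Y∂_Z` and `Y∂_Y - Z∂_Z` contains a nonzero multiple of a
power of `Y`. -/
theorem exists_smul_Y_pow_mem {W : Submodule k[X] k[X][X][X]} (hW : W ≤ VR R)
    (hR : ∀ r ∈ R, r < p) (hf : ∀ w ∈ W, C X * dZ w ∈ W)
    (hh : ∀ w ∈ W, C X * dY w - X * dZ w ∈ W) (hF : F ∈ W) (hF0 : F ≠ 0) :
    ∃ r ∈ R, ∃ c : k[X], c ≠ 0 ∧ c • (C X ^ r : k[X][X][X]) ∈ W := by
  obtain ⟨w, hw, hw0, hwZ⟩ := exists_mem_free_of_Z hW hR hf hF hF0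
  suffices H : ∀ s ⊆ R, ∀ (w : k[X][X][X]), w ∈ W → w ≠ 0 →
      (∀ j l, l ≠ 0 → cf w j l = 0) → (∀ j ∉ s, cf w j 0 = 0) →
      ∃ r ∈ R, ∃ c : k[X], c ≠ 0 ∧ c • (C X ^ r : k[X][X][X]) ∈ W from
    H R subset_rfl w hw hw0 hwZ fun j hj => hW hw j 0 hj
  clear hw hw0 hwZ hF hF0
  intro s
  induction s using Finset.induction_on with
  | empty =>
    intro _ w hw hw0 h1 h2
    refine absurd (cf_ext fun j l => ?_) hw0
    by_cases hl : l = 0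
    · rw [hl, h2 j (by simp), cf_zero]
    · rw [h1 j l hl, cf_zero]
  | insert r s hr ih =>
    intro hsR w hw hw0 h1 h2
    have hrR : r ∈ R := hsR (mem_insert_self r s)
    set w' := (C X * dY w - X * dZ w) + (-(r : k[X])) • w with hw'
    have hw'W : w' ∈ W := W.add_mem (hh w hw) (W.smul_mem _ hw)
    have hcf : ∀ j, cf w' j 0 = ((j : k[X]) - r) * cf w j 0 := fun j => by
      rw [hw', cf_add, cf_sub, cf_smul, cf_Y_mul, cf_X_mul, if_pos rfl]
      rcases j with _ | j
      · simp
      · rw [if_neg (by omega), cf_dY, Nat.add_sub_cancel]; push_cast; ring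
    have hcf' : ∀ j l, l ≠ 0 → cf w' j l = 0 := fun j l hl => by
      rw [hw', cf_add, cf_sub, cf_smul, cf_Y_mul, cf_X_mul, if_neg hl, h1 j l hl, cf_dY,
        cf_dZ, h1 _ _ hl, h1 _ (l - 1 + 1) (by omega)]
      simp
    by_cases hz : w' = 0
    · have h0 : ∀ j, j ≠ r → cf w j 0 = 0 := fun j hj => by
        by_cases hjs : j ∈ insert r s
        · by_cases hjR : j ∈ R
          · have h3 := hcf j
            rw [hz, cf_zero] at h3
            refine (mul_eq_zero.1 h3.symm).resolve_left fun h4 => ?_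
            have h5 : (j : k) = r := by
              have : C (j : k) = C (r : k) := by simpa using sub_eq_zero.1 h4
              exact C_injective this
            rw [CharP.cast_eq_iff_mod_eq k p, Nat.mod_eq_of_lt (hR j hjR),
              Nat.mod_eq_of_lt (hR r hrR)] at h5
            exact hj h5
          · exact hW hw j 0 hjR
        · exact h2 j hjs
      have hwr : w = cf w r 0 • (C X ^ r : k[X][X][X]) := by
        refine cf_ext fun j l => ?_
        rw [cf_smul, cf_Y_pow]
        by_cases hl : l = 0
        · subst hl
          by_cases hj : j = r
          · simp [hj]
          · simp [hj, h0 j hj]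
        · simp [hl, h1 j l hl]
      have hc0 : cf w r 0 ≠ 0 := fun h => hw0 (by rw [hwr, h]; simp)
      exact ⟨r, hrR, cf w r 0, hc0, hwr ▸ hw⟩
    · refine ih ((subset_insert r s).trans hsR) w' hw'W hz hcf' fun j hj => ?_
      rw [hcf]
      by_cases hjr : j = r
      · rw [hjr, sub_self, zero_mul]
      · rw [h2 j (by simp [hj, hjr]), mul_zero]

end LinSys

namespace LinSys

variable {k : Type*} [Field k] {p : ℕ} [Fact p.Prime] [CharP k p]
variable {R : Finset ℕ} {σ : k[X]} {F : k[X][X][X]}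

theorem YdY_sub_ZdZ_mem (hF : F ∈ VR R) : C X * dY F - X * dZ F ∈ VR R := by
  refine VR_sub_mem (fun j l h => ?_) (fun j l h => ?_)
  · rw [cf_Y_mul, cf_dY]
    split_ifs
    · rfl
    · rw [hF _ _ (by rwa [show j - 1 + 1 + l = j + l by omega]), mul_zero]
  · rw [cf_X_mul, cf_dZ]
    split_ifs
    · rfl
    · rw [hF _ _ (by rwa [show j + (l - 1 + 1) = j + l by omega]), mul_zero]

theorem natDegree_cf_YdY_sub_ZdZ_le {d : ℕ} (hF : ∀ j l, (cf F j l).natDegree ≤ d) (j l : ℕ) :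
    (cf (C X * dY F - X * dZ F) j l).natDegree ≤ d := by
  rw [cf_sub, cf_X_mul, cf_dZ, cf_Y_mul, cf_dY]
  exact (natDegree_sub_le _ _).trans (max_le (natDegree_cf_ite_le hF _ _ _ _)
    (natDegree_cf_ite_le hF _ _ _ _))

omit [Fact p.Prime] in
theorem X_pow_char_dvd_th0 {q : k[X]} (h : X ^ p ∣ q) : X ^ p ∣ th0 q := by
  obtain ⟨r, rfl⟩ := h
  rw [th0_apply, derivative_mul, derivative_X_pow, CharP.cast_eq_zero, C_0]
  exact ⟨X * (1 - X) * derivative r, by ring⟩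

theorem dvd_of_quadratic_relation {A : Type*} [CommRing A] {a b x y z : A} (hab : IsCoprime a b)
    (h : a * b * x + b ^ 2 * y - a ^ 2 * z = 0) : a ∣ y :=
  (hab.pow_right (n := 2)).dvd_of_dvd_mul_left ⟨a * z - b * x, by linear_combination h⟩

theorem dvd_of_linear_relation {A : Type*} [CommRing A] [IsDomain A] {a b x z : A}
    (hab : IsCoprime a b) (ha : a ≠ 0) (h : a * b * x - a ^ 2 * z = 0) : a ∣ x :=
  hab.dvd_of_dvd_mul_left ⟨z, mul_left_cancel₀ ha (by linear_combination h)⟩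

/-- The operator `Y ∂_Z` as a linear map. -/
def YdZ : k[X][X][X] →ₗ[k[X]] k[X][X][X] where
  toFun v := C X * dZ v
  map_add' v w := by rw [map_add, mul_add]
  map_smul' r v := by rw [Derivation.map_smul, mul_smul_comm, RingHom.id_apply]

/-- The operator `Y ∂_Y - Z ∂_Z` as a linear map. -/
def YdYsubZdZ : k[X][X][X] →ₗ[k[X]] k[X][X][X] where
  toFun v := C X * dY v - X * dZ v
  map_add' v w := by rw [map_add, map_add]; ring
  map_smul' r v := by
    rw [Derivation.map_smul, Derivation.map_smul, RingHom.id_apply]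
    simp only [smul_eq_C]
    ring

/-- The zero estimate: a nonzero polynomial in `H` and `H₁` of small degree is not divisible by
`X ^ p`. -/
theorem not_X_pow_dvd_ev (hσ : σ.natDegree ≤ 2) (hσ0 : σ.eval 0 = 0) {H H₁ : k[X]}
    (h1 : th0 H = H₁) (h2 : th0 H₁ = σ * H) (hH0 : H.eval 0 ≠ 0) {g h h₁ : k[X]}
    (hg : H = g * h) (hg₁ : H₁ = g * h₁) (hcop : IsCoprime h h₁)
    (hδ : p ≤ 12 * h.natDegree + 11) {A : ℕ} (hA : ∀ j l, (cf F j l).natDegree ≤ A)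
    (hR : ∀ r ∈ R, r < p) (hF : F ∈ VR R) (hF0 : F ≠ 0)
    (hp : 12 * (((mons R).card + 1) * (A + 2 * (mons R).card)) + 11 < p) :
    ¬X ^ p ∣ ev H H₁ F := by
  intro hdvd
  obtain ⟨n, hn, D, Φ, hD, hDdeg, hΦ, hΦ0, hΦdeg⟩ := exists_cramer_data (R := R) hσ hA
  set m := (mons R).card
  have hdeg1 : n * (A + 2 * n) + (A + 2 * n) ≤ (m + 1) * (A + 2 * m) := by
    rw [← Nat.succ_mul]
    gcongr
    omega
  have hGdeg : ∀ i < n, ∀ j l, (cf ((theta σ)^[i] F) j l).natDegree ≤ A + 2 * n :=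
    fun i hi j l => (natDegree_cf_iterate_theta_le hσ hA i j l).trans (by omega)
  have hGmem : ∀ i, (theta σ)^[i] F ∈ VR R := fun i => iterate_theta_mem hF i
  let W : Submodule k[X] k[X][X][X] := VR R ⊓ LinearMap.ker (Φ ∘ₗ vec R)
  have hWmem : ∀ v, v ∈ W ↔ v ∈ VR R ∧ Φ (vec R v) = 0 := fun v => by
    rw [Submodule.mem_inf, LinearMap.mem_ker, LinearMap.comp_apply]
  have hspan : ∀ v ∈ W, ∃ c : Fin n → k[X], D • v = ∑ i, c i • (theta σ)^[i] F := fun v hv => by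
    rw [hWmem] at hv
    obtain ⟨c, hc⟩ := hΦ0 _ hv.2
    refine ⟨c, vec_inj (R := R) ((VR R).smul_mem _ hv.1)
      (Submodule.sum_mem _ fun i _ => (VR R).smul_mem _ (hGmem i)) ?_⟩
    rw [map_smul, hc, map_sum]
    simp only [map_smul]
  have hcancel : ∀ v, Φ (vec R (D • v)) = 0 → Φ (vec R v) = 0 := fun v hv => by
    rw [map_smul, map_smul] at hv
    exact (smul_eq_zero.1 hv).resolve_left hD
  have htheta : ∀ v ∈ W, theta σ v ∈ W := fun v hv => by
    obtain ⟨c, hc⟩ := hspan v hv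
    have hv' := (hWmem v).1 hv
    refine (hWmem _).2 ⟨theta_mem hv'.1, hcancel _ ?_⟩
    have e1 := theta_smul (σ := σ) D v
    rw [hc, map_sum] at e1
    have e2 := congrArg (fun w => Φ (vec R w)) e1
    simp only [map_add, map_sum, map_smul, hv'.2, smul_zero, zero_add] at e2
    rw [map_smul, map_smul, ← e2]
    refine sum_eq_zero fun i _ => ?_
    rw [theta_smul, map_add, map_add, map_smul, map_smul, map_smul, map_smul, hΦ i (by omega),
      ← Function.iterate_succ_apply' (theta σ), hΦ (i + 1) (by omega)]
    simp
  have hlin : ∀ L : k[X][X][X] →ₗ[k[X]] k[X][X][X], (∀ i < n, Φ (vec R (L ((theta σ)^[i] F))) = 0) →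
      ∀ v ∈ W, Φ (vec R (L v)) = 0 := fun L hL v hv => by
    obtain ⟨c, hc⟩ := hspan v hv
    refine hcancel _ ?_
    rw [← map_smul, hc]
    simp only [map_sum, map_smul]
    refine sum_eq_zero fun i _ => ?_
    rw [hL i i.2, smul_zero]
  obtain ⟨β, hβ, hcurv⟩ := exists_curv_eq (p := p) hσ0 h1 h2
  have hH : H ≠ 0 := fun h => by simp [h] at hH0
  have hg0 : g ≠ 0 := fun h => hH (by rw [hg, h, zero_mul])
  have hh0 : h ≠ 0 := fun h => hH (by rw [hg, h, mul_zero])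
  have hGW : ∀ i ≤ n, (theta σ)^[i] F ∈ W := fun i hi => (hWmem _).2 ⟨hGmem i, hΦ i hi⟩
  have hiter : ∀ (N : ℕ), ∀ v ∈ W, (theta σ)^[N] v ∈ W := fun N v hv => by
    induction N with
    | zero => exact hv
    | succ N ih => rw [Function.iterate_succ_apply']; exact htheta _ ih
  have hrel : ∀ v ∈ W, ∀ c, h * h₁ * Φ (vec R (C X * dY v - X * dZ v)) c +
      h₁ ^ 2 * Φ (vec R (C X * dZ v)) c - h ^ 2 * Φ (vec R (X * dY v)) c = 0 := fun v hv c => by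
    have e1 : Φ (vec R (curv σ p v)) = 0 := by
      rw [curv_apply, map_sub (vec R), map_sub, ((hWmem _).1 (hiter p v hv)).2,
        ((hWmem _).1 (htheta v hv)).2, sub_zero]
    have e2 := congrArg (fun w => Φ (vec R w) c) (hcurv v)
    simp only [map_smul, Pi.smul_apply, e1, smul_eq_mul, Pi.zero_apply, mul_zero] at e2
    have e3 := (mul_eq_zero.1 e2.symm).resolve_left (neg_ne_zero.2 hβ)
    rw [map_sub (vec R), map_sub, map_add (vec R), map_add, map_smul, map_smul, map_smul, map_smul,
      map_smul, map_smul, Pi.sub_apply, Pi.add_apply, Pi.smul_apply, Pi.smul_apply, Pi.smul_apply,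
      smul_eq_mul, smul_eq_mul, smul_eq_mul, hg, hg₁] at e3
    refine (mul_eq_zero.1 ?_).resolve_left (pow_ne_zero 2 hg0)
    linear_combination e3
  have hsmall : ∀ q : k[X], q.natDegree ≤ n * (A + 2 * n) + (A + 2 * n) → h ∣ q → q = 0 :=
    fun q hq hd => eq_zero_of_dvd_of_natDegree_lt hd (by omega)
  have hf0 : ∀ i < n, Φ (vec R (C X * dZ ((theta σ)^[i] F))) = 0 := fun i hi => by
    ext1 c
    refine hsmall _ (hΦdeg _ _ (fun c => natDegree_cf_YdZ_le (hGdeg i hi) _ _) c) ?_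
    exact dvd_of_quadratic_relation hcop (hrel _ (hGW i hi.le) c)
  have hh0' : ∀ i < n, Φ (vec R (C X * dY ((theta σ)^[i] F) - X * dZ ((theta σ)^[i] F))) = 0 :=
    fun i hi => by
      ext1 c
      refine hsmall _ (hΦdeg _ _ (fun c => natDegree_cf_YdY_sub_ZdZ_le (hGdeg i hi) _ _) c) ?_
      have e := hrel _ (hGW i hi.le) c
      rw [hf0 i hi, Pi.zero_apply, mul_zero, add_zero] at e
      exact dvd_of_linear_relation hcop hh0 e
  obtain ⟨r, hr, c, hc, hcW⟩ := exists_smul_Y_pow_mem (p := p) (W := W) inf_le_left hR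
    (fun w hw => (hWmem _).2 ⟨YdZ_mem ((hWmem w).1 hw).1, hlin YdZ hf0 w hw⟩)
    (fun w hw => (hWmem _).2 ⟨YdY_sub_ZdZ_mem ((hWmem w).1 hw).1, hlin YdYsubZdZ hh0' w hw⟩)
    (hGW 0 (Nat.zero_le _)) hF0
  have hYW : (C X ^ r : k[X][X][X]) ∈ W := by
    rw [hWmem, map_smul, map_smul] at hcW
    refine (hWmem _).2 ⟨fun j l hjl => ?_, (smul_eq_zero.1 hcW.2).resolve_left hc⟩
    rw [cf_Y_pow, if_neg]
    rintro ⟨rfl, rfl⟩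
    exact hjl hr
  obtain ⟨a, ha⟩ := hspan _ hYW
  have hdvd2 : ∀ i, X ^ p ∣ ev H H₁ ((theta σ)^[i] F) := fun i => by
    induction i with
    | zero => exact hdvd
    | succ i ih =>
      rw [Function.iterate_succ_apply', ← th0_ev h1 h2]
      exact X_pow_char_dvd_th0 ih
  have hdvd3 : X ^ p ∣ D * H ^ r := by
    have e := congrArg (ev H H₁) ha
    rw [map_smul, map_pow, ev_Y, map_sum, smul_eq_mul] at e
    rw [e]
    refine dvd_sum fun i _ => ?_
    rw [map_smul, smul_eq_mul]
    exact (hdvd2 i).mul_left _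
  have hXH : ¬X ∣ H ^ r := fun h => by
    rw [X_dvd_iff, coeff_zero_eq_eval_zero, eval_pow] at h
    exact pow_ne_zero r hH0 h
  have hdvd4 : X ^ p ∣ D := by
    refine IsCoprime.dvd_of_dvd_mul_right ?_ hdvd3
    exact ((irreducible_X.coprime_iff_not_dvd).2 hXH).pow_left
  refine hD (eq_zero_of_dvd_of_natDegree_lt hdvd4 ?_)
  rw [natDegree_X_pow]
  omega

end LinSys

namespace LinSys

variable {k : Type*} [Field k]

theorem coeff_th0_succ (h : k[X]) (N : ℕ) :
    (th0 h).coeff (N + 1) = (N + 1) * h.coeff (N + 1) - N * h.coeff N := by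
  rw [th0_apply, mul_assoc, coeff_X_mul, sub_mul, one_mul, coeff_sub, coeff_derivative]
  rcases N with _ | N
  · simp
  · rw [coeff_X_mul, coeff_derivative]; push_cast; ring

theorem coeff_th0_add_succ {h : k[X]} {N : ℕ} (hN : h.natDegree ≤ N) (a : k) :
    (th0 h + C a * X * h).coeff (N + 1) = (a - N) * h.coeff N := by
  rw [coeff_add, coeff_th0_succ, coeff_eq_zero_of_natDegree_lt (by omega : h.natDegree < N + 1),
    mul_assoc, coeff_C_mul, coeff_X_mul]
  ring

theorem natDegree_th0_add_le {h : k[X]} {N : ℕ} (hN : h.natDegree ≤ N) (a : k) :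
    (th0 h + C a * X * h).natDegree ≤ N + 1 := by
  refine natDegree_add_le_of_degree_le ((natDegree_th0_le h).trans (by omega)) ?_
  rw [mul_assoc]
  refine (natDegree_C_mul_le _ _).trans (natDegree_mul_le.trans ?_)
  have := natDegree_X_le (R := k)
  omega

/-- The coefficient `X (31 - 27 X) / 144` of the second order equation. -/
def sig (k : Type*) [Field k] : k[X] := C (1 / 144 : k) * (X * (31 - 27 * X))

theorem natDegree_sig_le : (sig k).natDegree ≤ 2 := by
  rw [sig]; compute_degree

theorem eval_zero_sig : (sig k).eval 0 = 0 := by simp [sig]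

theorem exists_coprime_factorization {p : ℕ} [Fact p.Prime] [CharP k p] (hp : 5 ≤ p) {H H₁ : k[X]}
    (h1 : th0 H = H₁) (h2 : th0 H₁ = sig k * H) (hH0 : H.eval 0 ≠ 0) :
    ∃ g h h₁ : k[X], H = g * h ∧ H₁ = g * h₁ ∧ IsCoprime h h₁ ∧ p ≤ 12 * h.natDegree + 11 := by
  have hp' : p.Prime := Fact.out
  have hsm : ∀ n : ℕ, n ≠ 0 → n < p → (n : k) ≠ 0 := fun n h0 hn => natCast_ne_zero_of_lt h0 hn
  have two : (2 : k) ≠ 0 := by exact_mod_cast hsm 2 (by norm_num) (by omega)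
  have three : (3 : k) ≠ 0 := by exact_mod_cast hsm 3 (by norm_num) (by omega)
  have h144 : (144 : k) ≠ 0 := by
    rw [show (144 : k) = 2 ^ 4 * 3 ^ 2 by norm_num]
    exact mul_ne_zero (pow_ne_zero _ two) (pow_ne_zero _ three)
  have hH : H ≠ 0 := fun h => by simp [h] at hH0
  obtain ⟨g, h, h₁, hg, hg₁, hcop⟩ : ∃ g h h₁ : k[X], H = g * h ∧ H₁ = g * h₁ ∧ IsCoprime h h₁ := by
    obtain ⟨h, hh⟩ := EuclideanDomain.gcd_dvd_left H H₁
    obtain ⟨h₁, hh₁⟩ := EuclideanDomain.gcd_dvd_right H H₁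
    refine ⟨_, h, h₁, hh, hh₁, EuclideanDomain.gcdA H H₁, EuclideanDomain.gcdB H H₁, ?_⟩
    have hb := EuclideanDomain.gcd_eq_gcd_ab H H₁
    have hg : EuclideanDomain.gcd H H₁ ≠ 0 := fun h0 => hH (by rw [hh, h0, zero_mul])
    generalize EuclideanDomain.gcdA H H₁ = u at *
    generalize EuclideanDomain.gcdB H H₁ = v at *
    generalize EuclideanDomain.gcd H H₁ = g at *
    refine mul_left_cancel₀ hg ?_
    rw [hh, hh₁] at hb
    linear_combination -hb
  refine ⟨g, h, h₁, hg, hg₁, hcop, ?_⟩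
  have hg0 : g ≠ 0 := fun h => hH (by rw [hg, h, zero_mul])
  have hh0 : h ≠ 0 := fun h => hH (by rw [hg, h, mul_zero])
  have e1 : h * th0 g = g * (h₁ - th0 h) := by
    rw [hg, hg₁, Derivation.leibniz, smul_eq_mul, smul_eq_mul] at h1
    linear_combination h1
  have e2 : h₁ * th0 g = g * (sig k * h - th0 h₁) := by
    rw [hg, hg₁, Derivation.leibniz, smul_eq_mul, smul_eq_mul] at h2
    linear_combination h2
  obtain ⟨q, hq⟩ : g ∣ th0 g := by
    obtain ⟨u, v, huv⟩ := hcop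
    exact ⟨u * (h₁ - th0 h) + v * (sig k * h - th0 h₁), by
      linear_combination (-th0 g) * huv + u * e1 + v * e2⟩
  have hqdeg : q.natDegree ≤ 1 := by
    rcases eq_or_ne q 0 with rfl | hq0
    · simp
    · have := natDegree_th0_le g
      rw [hq, natDegree_mul hg0 hq0] at this
      omega
  have hgeval : g.eval 0 ≠ 0 := fun h => hH0 (by rw [hg, eval_mul, h, zero_mul])
  have hq0 : q.coeff 0 = 0 := by
    have := congrArg (eval 0) hq
    rw [eval_mul, th0_apply] at this
    rw [coeff_zero_eq_eval_zero]
    simpa [hgeval] using this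
  obtain ⟨a, rfl⟩ : ∃ a, q = C a * X := by
    refine ⟨q.coeff 1, ?_⟩
    conv_lhs => rw [eq_X_add_C_of_natDegree_le_one hqdeg, hq0, C_0, add_zero]
  have f1 : h₁ = th0 h + C a * X * h :=
    mul_left_cancel₀ hg0 (by linear_combination (-1) * e1 + h * hq)
  have f2 : th0 h₁ + C a * X * h₁ = sig k * h :=
    mul_left_cancel₀ hg0 (by linear_combination e2 - h₁ * hq)
  have ha : a ^ 2 * 36 = 1 := by
    have g1 : h₁.eval 1 = a * h.eval 1 := by rw [f1]; simp [th0_apply]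
    have g2 : a * h₁.eval 1 = 1 / 36 * h.eval 1 := by
      have := congrArg (eval 1) f2
      simp only [th0_apply, sig] at this
      simp at this
      rw [this, ← sub_eq_zero]
      have : (36 : k) ≠ 0 := by
        rw [show (36 : k) = 2 ^ 2 * 3 ^ 2 by norm_num]
        exact mul_ne_zero (pow_ne_zero _ two) (pow_ne_zero _ three)
      field_simp
      ring
    have g3 : h.eval 1 ≠ 0 := fun h0 => by
      obtain ⟨u, v, huv⟩ := hcop
      have := congrArg (eval 1) huv
      simp [h0, g1] at this
    have h36 : (36 : k) ≠ 0 := by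
      rw [show (36 : k) = 2 ^ 2 * 3 ^ 2 by norm_num]
      exact mul_ne_zero (pow_ne_zero _ two) (pow_ne_zero _ three)
    rw [g1] at g2
    field_simp at g2
    exact g2
  set δ := h.natDegree
  have c1 : h₁.coeff (δ + 1) = (a - δ) * h.leadingCoeff := by
    rw [f1]; exact coeff_th0_add_succ le_rfl a
  have c2 : (sig k * h).coeff (δ + 2) = (a - (δ + 1)) * h₁.coeff (δ + 1) := by
    rw [← f2, coeff_th0_add_succ (N := δ + 1) (by rw [f1]; exact natDegree_th0_add_le le_rfl a)]
    push_cast; ring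
  have c3 : (sig k * h).coeff (δ + 2) = -(27 / 144) * h.leadingCoeff := by
    have : sig k * h = C (31 / 144 : k) * (X * h) - C (27 / 144 : k) * (X * (X * h)) := by
      rw [sig]
      simp only [div_eq_mul_inv, C_mul, one_mul, map_ofNat]
      ring
    rw [this, coeff_sub, coeff_C_mul, coeff_C_mul, coeff_X_mul, coeff_X_mul, coeff_X_mul,
      coeff_eq_zero_of_natDegree_lt (by omega : h.natDegree < δ + 1)]
    simp only [δ, coeff_natDegree]; ring
  have c4 : (a - (δ + 1)) * (a - δ) = -(27 / 144) := by
    refine mul_right_cancel₀ (leadingCoeff_ne_zero.2 hh0) ?_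
    rw [← c3, c2, c1]; ring
  have c5 : ((12 * δ + 1 : ℕ) : k) * ((12 * δ + 5 : ℕ) : k) * ((12 * δ + 7 : ℕ) : k) *
      ((12 * δ + 11 : ℕ) : k) = 0 := by
    have c6 : 144 * ((a - (δ + 1)) * (a - δ)) = -27 := by rw [c4]; field_simp
    push_cast
    linear_combination ((12 * (δ : k) + 6 + 12 * a) ^ 2 - 9) * c6 +
      4 * (2 * (12 * (δ : k) + 6) ^ 2 - 144 * a ^ 2 + 14) * ha
  simp only [mul_eq_zero, CharP.cast_eq_zero_iff k p] at c5
  rcases c5 with ((h | h) | h) | h <;>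
  · have := Nat.le_of_dvd (by omega) h
    omega

end LinSys

namespace LinSys

variable {k : Type*} [Field k]

theorem cf_sum {ι : Type*} (s : Finset ι) (f : ι → k[X][X][X]) (j l : ℕ) :
    cf (∑ i ∈ s, f i) j l = ∑ i ∈ s, cf (f i) j l := by
  simp only [cf, finsetSum_coeff]

theorem cf_Y_pow_mul_Z_pow (a b j l : ℕ) :
    cf (C X ^ a * X ^ b : k[X][X][X]) j l = if (j, l) = (a, b) then 1 else 0 := by
  rw [← C_pow, cf, coeff_C_mul, coeff_X_pow]
  by_cases h : l = b
  · simp [h, coeff_X_pow]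
  · simp [h]

/-- The polynomial with given coefficients at the monomials in `mons R`. -/
def ofVec (R : Finset ℕ) (q : mons R → k[X]) : k[X][X][X] :=
  ∑ c : mons R, q c • (C X ^ c.1.1 * X ^ c.1.2 : k[X][X][X])

variable {R : Finset ℕ}

theorem cf_ofVec (q : mons R → k[X]) (j l : ℕ) :
    cf (ofVec R q) j l = if h : (j, l) ∈ mons R then q ⟨(j, l), h⟩ else 0 := by
  simp only [ofVec, cf_sum, cf_smul, cf_Y_pow_mul_Z_pow]
  split_ifs with h
  · rw [sum_eq_single ⟨(j, l), h⟩]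
    · simp
    · intro c _ hc
      rw [if_neg fun h' => hc (Subtype.ext h'.symm), mul_zero]
    · simp
  · refine sum_eq_zero fun c _ => ?_
    rw [if_neg fun h' => h (by rw [h']; exact c.2), mul_zero]

theorem ofVec_mem (q : mons R → k[X]) : ofVec R q ∈ VR R := fun j l h => by
  rw [cf_ofVec, dif_neg fun h' => h (mem_mons.1 h')]

theorem ofVec_vec {G : k[X][X][X]} (hG : G ∈ VR R) : ofVec R (vec R G) = G := by
  refine vec_inj (ofVec_mem _) hG ?_
  ext1 c
  rw [vec_apply, cf_ofVec, dif_pos c.2]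

theorem ev_eq_sum {G : k[X][X][X]} (hG : G ∈ VR R) (H H₁ : k[X]) :
    ev H H₁ G = ∑ c ∈ mons R, cf G c.1 c.2 * (H ^ c.1 * H₁ ^ c.2) := by
  conv_lhs => rw [← ofVec_vec hG]
  rw [ofVec, map_sum, ← sum_coe_sort (mons R)]
  refine sum_congr rfl fun c _ => ?_
  rw [map_smul, map_mul, map_pow, map_pow, ev_Y, ev_Z, smul_eq_mul, vec_apply]

variable {p : ℕ} [CharP k p]

theorem eval_th0_iterate_ne_zero {x : k} (hx0 : x ≠ 0) (hx1 : x ≠ 1) (m : ℕ) (hm : m < p) (q : k[X])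
    (hq : q.eval x ≠ 0) : (th0^[m] ((X - C x) ^ m * q)).eval x ≠ 0 := by
  induction m generalizing q with
  | zero => simpa using hq
  | succ m ih =>
    have h : th0 ((X - C x) ^ (m + 1) * q) = (X - C x) ^ m *
        (((m + 1 : ℕ) : k[X]) * (X * (1 - X)) * q + (X - C x) * th0 q) := by
      rw [th0_apply, th0_apply, derivative_mul, derivative_X_sub_C_pow, Nat.add_sub_cancel]
      simp only [C_eq_natCast]
      ring
    rw [Function.iterate_succ_apply, h]
    refine ih (by omega) _ ?_
    have h1 : ((m + 1 : ℕ) : k) ≠ 0 := natCast_ne_zero_of_lt (by omega) hm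
    have h2 : 1 - x ≠ 0 := sub_ne_zero.2 hx1.symm
    simp only [eval_add, eval_mul, eval_natCast, eval_X, eval_sub, eval_one, eval_C, sub_self,
      zero_mul, add_zero]
    exact mul_ne_zero (mul_ne_zero h1 (mul_ne_zero hx0 h2)) hq

theorem pow_dvd_of_eval_th0_iterate {x : k} (hx0 : x ≠ 0) (hx1 : x ≠ 1) {D : ℕ} (hD : D ≤ p)
    {q : k[X]} (hq : ∀ n < D, (th0^[n] q).eval x = 0) : (X - C x) ^ D ∣ q := by
  rcases eq_or_ne q 0 with rfl | hq0
  · simp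
  rw [← le_rootMultiplicity_iff hq0]
  by_contra! h
  obtain ⟨r, hr, hr'⟩ := exists_eq_pow_rootMultiplicity_mul_and_not_dvd q hq0 x
  refine eval_th0_iterate_ne_zero hx0 hx1 _ (h.trans_le hD) r (fun h0 => hr' (dvd_iff_isRoot.2 h0))
    ?_
  rw [← hr]
  exact hq _ h

theorem card_mul_le_natDegree {q : k[X]} (hq0 : q ≠ 0) {D : ℕ} (S : Finset k)
    (h : ∀ x ∈ S, (X - C x) ^ D ∣ q) : S.card * D ≤ q.natDegree := by
  have h1 : ∏ x ∈ S, (X - C x) ^ D ∣ q := by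
    refine Finset.prod_dvd_of_coprime (fun x _ y _ hxy => ?_) h
    exact (isCoprime_X_sub_C_of_isUnit_sub (sub_ne_zero.2 hxy).isUnit).pow
  have h2 := natDegree_le_of_dvd h1 hq0
  rw [natDegree_prod _ _ fun x _ => pow_ne_zero _ (X_sub_C_ne_zero x)] at h2
  simpa using h2

end LinSys

namespace LinSys

variable {k : Type*} [Field k] {R : Finset ℕ} {K A : ℕ} {σ : k[X]}

theorem iterate_theta_add (F G : k[X][X][X]) (n : ℕ) :
    (theta σ)^[n] (F + G) = (theta σ)^[n] F + (theta σ)^[n] G := by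
  induction n with
  | zero => rfl
  | succ n ih => simp only [Function.iterate_succ_apply', ih]; exact map_add (theta σ) _ _

theorem iterate_theta_C_smul (c : k) (F : k[X][X][X]) (n : ℕ) :
    (theta σ)^[n] ((C c : k[X]) • F) = (C c : k[X]) • (theta σ)^[n] F := by
  induction n with
  | zero => rfl
  | succ n ih =>
    rw [Function.iterate_succ_apply', ih, theta_smul, Function.iterate_succ_apply', th0_apply,
      derivative_C, mul_zero, zero_smul, zero_add]

/-- The polynomial with coefficient vector `u`, for the `i`-th block of coefficients. -/
def auxPoly (u : Fin K × mons R × Fin A → k) (i : Fin K) : k[X][X][X] :=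
  ofVec R fun c => ∑ s : Fin A, C (u (i, c, s)) * X ^ (s : ℕ)

theorem cf_auxPoly (u : Fin K × mons R × Fin A → k) (i : Fin K) (j l : ℕ) :
    cf (auxPoly u i) j l = if h : (j, l) ∈ mons R then
      ∑ s : Fin A, C (u (i, ⟨(j, l), h⟩, s)) * X ^ (s : ℕ) else 0 := by
  rw [auxPoly, cf_ofVec]

theorem auxPoly_add (u v : Fin K × mons R × Fin A → k) (i : Fin K) :
    auxPoly (u + v) i = auxPoly u i + auxPoly v i := by
  refine cf_ext fun j l => ?_
  rw [cf_add, cf_auxPoly, cf_auxPoly, cf_auxPoly]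
  split_ifs
  · simp [add_mul, sum_add_distrib]
  · simp

theorem auxPoly_smul (a : k) (u : Fin K × mons R × Fin A → k) (i : Fin K) :
    auxPoly (a • u) i = (C a : k[X]) • auxPoly u i := by
  refine cf_ext fun j l => ?_
  rw [cf_smul, cf_auxPoly, cf_auxPoly]
  split_ifs
  · simp [mul_sum, mul_assoc]
  · simp

theorem auxPoly_ne_zero {u : Fin K × mons R × Fin A → k} (hu : u ≠ 0) : ∃ i, auxPoly u i ≠ 0 := by
  by_contra! h
  refine hu (funext fun ⟨i, c, s⟩ => ?_)
  have h1 : cf (auxPoly u i) c.1.1 c.1.2 = 0 := by rw [h i, cf_zero]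
  rw [cf_auxPoly, dif_pos c.2] at h1
  have h2 := congrArg (fun q => q.coeff (s : ℕ)) h1
  simp only [finsetSum_coeff, coeff_C_mul, coeff_X_pow, coeff_zero] at h2
  rw [sum_eq_single s] at h2
  · simpa using h2
  · intro t _ ht
    rw [if_neg fun h' => ht (Fin.ext h'.symm), mul_zero]
  · simp

theorem natDegree_cf_auxPoly_le (u : Fin K × mons R × Fin A → k) (i : Fin K) (j l : ℕ) :
    (cf (auxPoly u i) j l).natDegree ≤ A := by
  rw [cf_auxPoly]
  split_ifs
  · refine natDegree_sum_le_of_forall_le _ _ fun s _ => ?_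
    exact (natDegree_C_mul_X_pow_le _ _).trans s.2.le
  · simp

theorem auxPoly_mem (u : Fin K × mons R × Fin A → k) (i : Fin K) : auxPoly u i ∈ VR R :=
  ofVec_mem _

/-- The coefficient of `T ^ l` after substituting `a` for `Y` and `T` for `Z` in the `n`-th
derivative of the auxiliary function. -/
def condPoly (σ : k[X]) (B : ℕ) (a : k) (n l : ℕ) (u : Fin K × mons R × Fin A → k) : k[X] :=
  ∑ i : Fin K, X ^ (i : ℕ) * ∑ j ∈ range (B + 1), C (a ^ j) * cf ((theta σ)^[n] (auxPoly u i)) j l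

theorem condPoly_add (B : ℕ) (a : k) (n l : ℕ) (u v : Fin K × mons R × Fin A → k) :
    condPoly σ B a n l (u + v) = condPoly σ B a n l u + condPoly σ B a n l v := by
  simp only [condPoly, auxPoly_add, iterate_theta_add, cf_add, mul_add, sum_add_distrib]

theorem condPoly_smul (B : ℕ) (a : k) (n l : ℕ) (c : k) (u : Fin K × mons R × Fin A → k) :
    condPoly σ B a n l (c • u) = C c * condPoly σ B a n l u := by
  simp only [condPoly, auxPoly_smul, iterate_theta_C_smul, cf_smul, mul_sum]
  exact sum_congr rfl fun i _ => sum_congr rfl fun j _ => by ring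

theorem natDegree_condPoly_lt (hσ : σ.natDegree ≤ 2) (B : ℕ) (a : k) {n D : ℕ} (hn : n < D) (l : ℕ)
    (u : Fin K × mons R × Fin A → k) (hK : 0 < K) :
    (condPoly σ B a n l u).natDegree < A + K + 2 * D := by
  refine Nat.lt_of_le_of_lt (m := K - 1 + (A + 2 * n)) ?_ (by omega)
  refine natDegree_sum_le_of_forall_le _ _ fun i _ => ?_
  refine natDegree_mul_le_of_le ((natDegree_X_pow_le _).trans (by omega)) ?_
  refine natDegree_sum_le_of_forall_le _ _ fun j _ => (natDegree_C_mul_le _ _).trans ?_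
  exact natDegree_cf_iterate_theta_le hσ (natDegree_cf_auxPoly_le u i) n j l

theorem exists_auxPoly (hσ : σ.natDegree ≤ 2) (B D : ℕ) (a : k) (J : Finset ℕ)
    (hcount : D * J.card * (A + K + 2 * D) < K * A * (mons R).card) :
    ∃ u : Fin K × mons R × Fin A → k, u ≠ 0 ∧
      ∀ n < D, ∀ l ∈ J, condPoly σ B a n l u = 0 := by
  let L : (Fin K × mons R × Fin A → k) →ₗ[k] (Fin D × J × Fin (A + K + 2 * D) → k) :=
    { toFun := fun u t => (condPoly σ B a t.1 t.2.1 u).coeff t.2.2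
      map_add' := fun u v => by ext t; rw [condPoly_add, coeff_add]; rfl
      map_smul' := fun c u => by ext t; rw [condPoly_smul, coeff_C_mul]; rfl }
  have hker : LinearMap.ker L ≠ ⊥ := LinearMap.ker_ne_bot_of_finrank_lt (by
    rw [Module.finrank_fintype_fun_eq_card, Module.finrank_fintype_fun_eq_card]
    simp only [Fintype.card_prod, Fintype.card_fin, Fintype.card_coe]
    linarith)
  obtain ⟨u, hu, hu0⟩ := Submodule.exists_mem_ne_zero_of_ne_bot hker
  have hK : 0 < K := Nat.pos_of_ne_zero fun h => by simp [h] at hcount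
  refine ⟨u, hu0, fun n hn l hl => ?_⟩
  ext s
  rw [coeff_zero]
  by_cases hs : s < A + K + 2 * D
  · exact congrFun (LinearMap.mem_ker.1 hu) (⟨n, hn⟩, ⟨l, hl⟩, ⟨s, hs⟩)
  · exact coeff_eq_zero_of_natDegree_lt
      ((natDegree_condPoly_lt hσ B a hn l u hK).trans_le (not_lt.1 hs))

end LinSys

namespace LinSys

variable {k : Type*} [Field k] {R : Finset ℕ} {K A : ℕ} {σ : k[X]} {p : ℕ} [Fact p.Prime]
  [CharP k p]

omit [Fact p.Prime] in
theorem th0_X_pow_char_mul (i : ℕ) (q : k[X]) : th0 (X ^ (p * i) * q) = X ^ (p * i) * th0 q := by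
  simp [th0_apply, mul_left_comm]

omit [Fact p.Prime] in
theorem iterate_th0_X_pow_char_mul (n i : ℕ) (q : k[X]) :
    th0^[n] (X ^ (p * i) * q) = X ^ (p * i) * th0^[n] q := by
  induction n with
  | zero => rfl
  | succ n ih => rw [Function.iterate_succ_apply', ih, th0_X_pow_char_mul,
    Function.iterate_succ_apply']

theorem iterate_th0_sum {ι : Type*} (s : Finset ι) (q : ι → k[X]) (n : ℕ) :
    th0^[n] (∑ i ∈ s, q i) = ∑ i ∈ s, th0^[n] (q i) := by
  induction n with
  | zero => rfl
  | succ n ih =>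
    rw [Function.iterate_succ_apply', ih, map_sum]
    simp only [Function.iterate_succ_apply']

theorem natDegree_ev_le {H H₁ : k[X]} {d B : ℕ} (hH : H.natDegree ≤ d) (hH₁ : H₁.natDegree ≤ d)
    (hR : ∀ r ∈ R, r ≤ B) {G : k[X][X][X]} (hG : G ∈ VR R)
    (hA : ∀ j l, (cf G j l).natDegree ≤ A) : (ev H H₁ G).natDegree ≤ A + d * B := by
  rw [ev_eq_sum hG]
  refine natDegree_sum_le_of_forall_le _ _ fun c hc => natDegree_mul_le_of_le (hA _ _) ?_
  refine (natDegree_mul_le_of_le (natDegree_pow_le_of_le c.1 hH)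
    (natDegree_pow_le_of_le c.2 hH₁)).trans ?_
  rw [← add_mul, mul_comm]
  exact Nat.mul_le_mul_left _ (hR _ (mem_mons.1 hc))

theorem eval_ev {H H₁ : k[X]} {B : ℕ} (hR : ∀ r ∈ R, r ≤ B) {G : k[X][X][X]} (hG : G ∈ VR R)
    (x : k) : (ev H H₁ G).eval x = ∑ l ∈ range (B + 1), (H₁.eval x) ^ l *
      ∑ j ∈ range (B + 1), (H.eval x) ^ j * (cf G j l).eval x := by
  rw [ev_eq_sum hG, eval_finsetSum]
  simp only [mul_sum, eval_mul, eval_pow]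
  rw [sum_comm, ← sum_product']
  refine (sum_subset (fun c hc => ?_) fun c _ hc => ?_).trans (sum_congr rfl fun c _ => ?_)
  · have := hR _ (mem_mons.1 hc)
    simp only [mem_product, mem_range]
    omega
  · rw [hG _ _ fun h => hc (mem_mons.2 h), eval_zero, zero_mul]
  · ring

omit [Fact p.Prime] in
theorem eval_iterate_th0_eq_zero {H H₁ : k[X]} (h1 : th0 H = H₁) (h2 : th0 H₁ = σ * H)
    {B : ℕ} (hR : ∀ r ∈ R, r ≤ B) {a : k} {J : Finset ℕ}
    (hJ : ∀ j l, j + l ∈ R → l ∉ J → a ^ j = 0) {u : Fin K × mons R × Fin A → k} {n : ℕ}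
    (hu : ∀ l ∈ J, condPoly σ B a n l u = 0) {x : k} (hxp : x ^ p = x) (hx : H.eval x = a) :
    (th0^[n] (∑ i : Fin K, X ^ (p * (i : ℕ)) * ev H H₁ (auxPoly u i))).eval x = 0 := by
  rw [iterate_th0_sum, eval_finsetSum]
  have hterm : ∀ i : Fin K, (th0^[n] (X ^ (p * (i : ℕ)) * ev H H₁ (auxPoly u i))).eval x =
      ∑ l ∈ range (B + 1), (H₁.eval x) ^ l * (x ^ (i : ℕ) *
        ∑ j ∈ range (B + 1), a ^ j * (cf ((theta σ)^[n] (auxPoly u i)) j l).eval x) := fun i => by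
    rw [iterate_th0_X_pow_char_mul, ← ev_iterate_theta h1 h2, eval_mul, eval_pow, eval_X, pow_mul,
      hxp, eval_ev hR (iterate_theta_mem (auxPoly_mem u i) n), hx, mul_sum]
    exact sum_congr rfl fun l _ => by ring
  rw [sum_congr rfl fun i _ => hterm i, sum_comm]
  refine sum_eq_zero fun l _ => ?_
  rw [← mul_sum]
  by_cases hl : l ∈ J
  · have h3 := congrArg (eval x) (hu l hl)
    simp only [condPoly, eval_finsetSum, eval_mul, eval_pow, eval_X, eval_C, eval_zero] at h3
    rw [h3, mul_zero]
  · refine mul_eq_zero_of_right _ (sum_eq_zero fun i _ => mul_eq_zero_of_right _ ?_)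
    refine sum_eq_zero fun j _ => ?_
    by_cases hjl : j + l ∈ R
    · rw [hJ j l hjl hl, zero_mul]
    · rw [iterate_theta_mem (auxPoly_mem u i) n j l hjl, eval_zero, mul_zero]

theorem sum_X_pow_mul_ne_zero {M : ℕ} (q : Fin K → k[X]) (hq : ∃ i, q i ≠ 0)
    (hX : ∀ i, q i ≠ 0 → ¬X ^ M ∣ q i) : ∑ i : Fin K, X ^ (M * (i : ℕ)) * q i ≠ 0 := by
  intro h
  obtain ⟨i₀, hi₀, hmin⟩ := WellFounded.has_min (wellFounded_lt (α := Fin K)) {i | q i ≠ 0} hq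
  refine hX i₀ hi₀ ?_
  rw [← add_sum_erase _ _ (mem_univ i₀)] at h
  have hdvd : (X : k[X]) ^ (M * (i₀ : ℕ)) * X ^ M ∣
      ∑ i ∈ univ.erase i₀, X ^ (M * (i : ℕ)) * q i := by
    refine dvd_sum fun i hi => ?_
    rcases eq_or_ne (q i) 0 with h0 | h0
    · simp [h0]
    · have h1 : (i₀ : ℕ) < i := lt_of_le_of_ne (not_lt.1 (hmin i h0))
        fun h => (mem_erase.1 hi).1 (Fin.ext h.symm)
      rw [← pow_add]
      refine Dvd.dvd.mul_right (pow_dvd_pow _ ?_) _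
      calc M * (i₀ : ℕ) + M = M * (i₀ + 1) := by ring
        _ ≤ M * i := Nat.mul_le_mul_left _ h1
  rw [eq_neg_of_add_eq_zero_right h, dvd_neg] at hdvd
  exact (mul_dvd_mul_iff_left (pow_ne_zero _ X_ne_zero)).1 hdvd

theorem card_level_mul_le (hp5 : 5 ≤ p) {H H₁ : k[X]} (h1 : th0 H = H₁)
    (h2 : th0 H₁ = sig k * H) (hH0 : H.eval 0 ≠ 0) (hdeg : H.natDegree ≤ p)
    (hdeg₁ : H₁.natDegree ≤ p)
    {B D : ℕ} (hR : ∀ r ∈ R, r ≤ B) (hB : B < p) {a : k} {J : Finset ℕ}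
    (hJ : ∀ j l, j + l ∈ R → l ∉ J → a ^ j = 0) (hD : D ≤ p)
    (hcount : D * J.card * (A + K + 2 * D) < K * A * (mons R).card)
    (hp : 12 * (((mons R).card + 1) * (A + 2 * (mons R).card)) + 11 < p) (S : Finset k)
    (hS : ∀ x ∈ S, x ^ p = x ∧ x ≠ 0 ∧ x ≠ 1 ∧ H.eval x = a) :
    S.card * D ≤ p * K + A + p * B := by
  obtain ⟨u, hu0, hu⟩ := exists_auxPoly (natDegree_sig_le (k := k)) B D a J hcount
  obtain ⟨g, h, h₁, hg, hg₁, hcop, hδ⟩ := exists_coprime_factorization hp5 h1 h2 hH0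
  have hX : ∀ i, auxPoly u i ≠ 0 → ¬X ^ p ∣ ev H H₁ (auxPoly u i) := fun i hi =>
    not_X_pow_dvd_ev natDegree_sig_le eval_zero_sig h1 h2 hH0 hg hg₁ hcop hδ
      (natDegree_cf_auxPoly_le u i) (fun r hr => (hR r hr).trans_lt hB) (auxPoly_mem u i) hi hp
  have hne : ∑ i : Fin K, X ^ (p * (i : ℕ)) * ev H H₁ (auxPoly u i) ≠ 0 := by
    obtain ⟨i, hi⟩ := auxPoly_ne_zero hu0
    refine sum_X_pow_mul_ne_zero _ ⟨i, fun h0 => hX i hi (by rw [h0]; exact dvd_zero _)⟩ ?_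
    intro i hi
    refine hX i fun h0 => hi ?_
    rw [h0]
    exact map_zero (ev H H₁)
  refine (card_mul_le_natDegree hne S (D := D) fun x hx => ?_).trans ?_
  · obtain ⟨hxp, hx0, hx1, hxa⟩ := hS x hx
    exact pow_dvd_of_eval_th0_iterate hx0 hx1 hD fun n hn =>
      eval_iterate_th0_eq_zero h1 h2 hR hJ (hu n hn) hxp hxa
  · refine natDegree_sum_le_of_forall_le _ _ fun i _ => ?_
    rw [add_assoc]
    refine natDegree_mul_le_of_le ((natDegree_X_pow_le _).trans (Nat.mul_le_mul_left _ i.2.le)) ?_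
    exact natDegree_ev_le hdeg hdeg₁ hR (auxPoly_mem u i) (natDegree_cf_auxPoly_le u i)

/-- Level sets of `H` over the prime field. -/
theorem card_level_mul_le_general (hp5 : 5 ≤ p) {H H₁ : k[X]} (h1 : th0 H = H₁)
    (h2 : th0 H₁ = sig k * H) (hH0 : H.eval 0 ≠ 0) (hdeg : H.natDegree ≤ p)
    (hdeg₁ : H₁.natDegree ≤ p)
    {q : ℕ} (hq : 0 < q) (hqp : 3000 * q ^ 4 ≤ p) (a : k) (S : Finset k)
    (hS : ∀ x ∈ S, x ^ p = x ∧ x ≠ 0 ∧ x ≠ 1 ∧ H.eval x = a) :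
    S.card * q ^ 2 ≤ 6 * p * q + q ^ 2 := by
  have hm : 2 * (mons (range (3 * q + 1))).card = (3 * q + 1) * (3 * q + 2) := by
    rw [card_mons]
    generalize 3 * q = n
    induction n with
    | zero => simp
    | succ n ih => rw [sum_range_succ, mul_add, ih]; ring
  have hq1 : q ≤ q ^ 2 := Nat.le_self_pow (by norm_num) q
  have hq2 : q ^ 2 ≤ q ^ 4 := Nat.pow_le_pow_right hq (by norm_num)
  have key := card_level_mul_le (R := range (3 * q + 1)) (K := 3 * q) (A := q ^ 2) (B := 3 * q)
    (D := q ^ 2) (J := range (3 * q + 1)) (a := a) hp5 h1 h2 hH0 hdeg hdeg₁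
    (fun r hr => by simp at hr; omega) (by omega)
    (fun j l h h' => absurd (mem_range.2 (by have := mem_range.1 h; omega)) h') (by omega)
    (by
      rw [card_range]
      nlinarith [mul_pos hq hq, mul_pos (mul_pos hq hq) hq,
        mul_pos (mul_pos hq hq) (mul_pos hq hq)])
    (by
      have h3 : (mons (range (3 * q + 1))).card ≤ 10 * q ^ 2 := by nlinarith
      have h4 : 12 * (((mons (range (3 * q + 1))).card + 1) *
          (q ^ 2 + 2 * (mons (range (3 * q + 1))).card)) + 11 ≤
          12 * ((10 * q ^ 2 + q ^ 2) * (q ^ 2 + 2 * (10 * q ^ 2))) + 11 * q ^ 4 := by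
        gcongr <;> nlinarith
      nlinarith [pow_pos hq 4]) S hS
  linarith

theorem card_level_mul_le_zero (hp5 : 5 ≤ p) {H H₁ : k[X]} (h1 : th0 H = H₁)
    (h2 : th0 H₁ = sig k * H) (hH0 : H.eval 0 ≠ 0) (hdeg : H.natDegree ≤ p)
    (hdeg₁ : H₁.natDegree ≤ p)
    {q : ℕ} (hq : 0 < q) (hqp : 400 * q ^ 3 ≤ p) (S : Finset k)
    (hS : ∀ x ∈ S, x ^ p = x ∧ x ≠ 0 ∧ x ≠ 1 ∧ H.eval x = 0) :
    S.card * q ^ 2 ≤ 4 * p * q + q ^ 2 := by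
  have hm : (mons {2 * q}).card = 2 * q + 1 := by rw [card_mons, sum_singleton]
  have hq1 : q ≤ q ^ 2 := Nat.le_self_pow (by norm_num) q
  have hq2 : q ^ 2 ≤ q ^ 3 := Nat.pow_le_pow_right hq (by norm_num)
  have key := card_level_mul_le (R := {2 * q}) (K := 2 * q) (A := q ^ 2) (B := 2 * q)
    (D := q ^ 2) (J := {2 * q}) (a := 0) hp5 h1 h2 hH0 hdeg hdeg₁
    (fun r hr => by simp at hr; omega) (by omega)
    (fun j l h h' => by
      simp only [mem_singleton] at h h'
      exact zero_pow (by omega)) (by omega)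
    (by
      rw [card_singleton, hm]
      nlinarith [mul_pos hq hq, mul_pos (mul_pos hq hq) hq,
        mul_pos (mul_pos hq hq) (mul_pos hq hq)])
    (by
      rw [hm]
      have h4 : 12 * ((2 * q + 1 + 1) * (q ^ 2 + 2 * (2 * q + 1))) + 11 ≤
          12 * ((2 * q + q + q) * (q ^ 2 + 2 * (2 * q ^ 2 + q ^ 2))) + 11 * q ^ 3 := by
        gcongr <;> nlinarith
      nlinarith [pow_pos hq 3]) S hS
  linarith

end LinSys

namespace LinSys

section Hasse

variable (k : Type*) [Field k]

/-- The cubic `X³ + 3X² + 3sX + s`, with the parameter `s` as the inner variable. -/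
def famCubic : k[X][X] := X ^ 3 + 3 * X ^ 2 + C X * (3 * X + 1)

/-- The coefficient of `X ^ (2 m)` in the `m`-th power of the family of cubics. -/
def hassePoly (m : ℕ) : k[X] := (famCubic k ^ m).coeff (2 * m)

variable {k}

theorem natDegree_coeff_famCubic_le (i : ℕ) : ((famCubic k).coeff i).natDegree ≤ 1 := by
  have h : famCubic k = X ^ 3 + C 3 * X ^ 2 + C (3 * X) * X + C X := by
    simp only [famCubic, C_mul, map_ofNat]; ring
  rw [h]
  simp only [coeff_add, coeff_X_pow, coeff_C_mul, coeff_X, coeff_C]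
  refine natDegree_add_le_of_degree_le (natDegree_add_le_of_degree_le
    (natDegree_add_le_of_degree_le ?_ ?_) ?_) ?_
  all_goals split_ifs
  all_goals first | (simp; done) | (compute_degree)

theorem natDegree_coeff_pow_le {F : k[X][X]} (hF : ∀ i, (F.coeff i).natDegree ≤ 1) (m i : ℕ) :
    ((F ^ m).coeff i).natDegree ≤ m := by
  induction m generalizing i with
  | zero =>
    rw [pow_zero, coeff_one]
    split_ifs <;> simp
  | succ m ih =>
    rw [pow_succ, coeff_mul]
    exact natDegree_sum_le_of_forall_le _ _ fun c _ => natDegree_mul_le_of_le (ih _) (hF _)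

theorem natDegree_hassePoly_le (m : ℕ) : (hassePoly k m).natDegree ≤ m :=
  natDegree_coeff_pow_le natDegree_coeff_famCubic_le _ _

theorem eval_hassePoly (m : ℕ) (s : k) : (hassePoly k m).eval s =
    ((X ^ 3 + 3 * X ^ 2 + C s * (3 * X + 1) : k[X]) ^ m).coeff (2 * m) := by
  have h : (famCubic k).map (evalRingHom s) = X ^ 3 + 3 * X ^ 2 + C s * (3 * X + 1) := by
    simp [famCubic]
  rw [← h, ← Polynomial.map_pow, coeff_map]
  rfl

theorem eval_zero_hassePoly (m : ℕ) : (hassePoly k m).eval 0 = 3 ^ m := by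
  rw [eval_hassePoly, C_0, zero_mul, add_zero,
    show (X ^ 3 + 3 * X ^ 2 : k[X]) = X ^ 2 * (X + C 3) by rw [map_ofNat]; ring, mul_pow, ← pow_mul,
    coeff_X_pow_mul', if_pos le_rfl, Nat.sub_self, coeff_zero_eq_eval_zero]
  simp

theorem picardFuchs_identity {A : Type*} [CommRing A] (s x n : A) (h : 2 * n + 5 = 0)
    (f f₁ f₂ f' Q Q' : A)
    (hf : f = x ^ 3 + 3 * x ^ 2 + s * (3 * x + 1)) (hf₁ : f₁ = s * (1 - s) * (3 * x + 1))
    (hf₂ : f₂ = s * (1 - s) * ((1 - 2 * s) * (3 * x + 1))) (hf' : f' = 3 * x ^ 2 + 6 * x + 3 * s)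
    (hQ : Q = (31 - 27 * s) * x ^ 4 + (124 - 108 * s) * x ^ 3 + (99 - 48 * s - 27 * s ^ 2) * x ^ 2 +
      (18 + 16 * s - 18 * s ^ 2) * x + (7 * s - 3 * s ^ 2))
    (hQ' : Q' = 4 * (31 - 27 * s) * x ^ 3 + 3 * (124 - 108 * s) * x ^ 2 +
      2 * (99 - 48 * s - 27 * s ^ 2) * x + (18 + 16 * s - 18 * s ^ 2)) :
    144 * ((n + 2) * ((n + 1) * f₁ ^ 2 + f * f₂)) =
      s * (31 - 27 * s) * f ^ 2 + 2 * s * (Q' * f + (n + 1) * (Q * f')) := by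
  have e : 144 * ((n + 2) * ((n + 1) * f₁ ^ 2 + f * f₂)) - (s * (31 - 27 * s) * f ^ 2 +
      2 * s * (Q' * f + (n + 1) * (Q * f'))) = (2 * n + 5) *
      (36 * (2 * n + 1) * f₁ ^ 2 + 72 * f * f₂ - s * Q * f') := by
    have e1 : 108 * f₁ ^ 2 - 72 * f * f₂ - (s * (31 - 27 * s) * f ^ 2 +
      2 * s * Q' * f - 3 * s * Q * f') = 0 := by
      rw [hf, hf₁, hf₂, hf', hQ, hQ']; ring
    linear_combination e1
  rw [h, zero_mul] at e
  exact sub_eq_zero.1 e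

theorem th0_X : th0 (X : k[X]) = X * (1 - X) := by simp [th0_apply]

theorem onCoeff_famCubic : th0.onCoeff (famCubic k) =
    C X * (1 - C X) * (3 * X + 1) := by
  have h3 : th0.onCoeff (3 : k[X][X]) = 0 := (th0.onCoeff).map_natCast 3
  simp only [famCubic, map_add, Derivation.leibniz, Derivation.leibniz_pow, Derivation.onCoeff_X,
    Derivation.onCoeff_C, th0_X, h3, Derivation.map_one_eq_zero, smul_eq_mul, C_mul, C_sub, C_1]
  simp [mul_comm]

theorem onCoeff_onCoeff_famCubic : th0.onCoeff (th0.onCoeff (famCubic k)) =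
    C X * (1 - C X) * ((1 - 2 * C X) * (3 * X + 1)) := by
  have h3 : th0.onCoeff (3 : k[X][X]) = 0 := (th0.onCoeff).map_natCast 3
  rw [onCoeff_famCubic]
  simp only [map_add, map_sub, Derivation.leibniz, Derivation.onCoeff_X,
    Derivation.onCoeff_C, th0_X, h3, Derivation.map_one_eq_zero, smul_eq_mul, C_mul, C_1]
  ring

theorem derivative_quartic {A : Type*} [CommRing A] (a b c d e : A) :
    derivative (C a * X ^ 4 + C b * X ^ 3 + C c * X ^ 2 + C d * X + C e) =
      4 * C a * X ^ 3 + 3 * C b * X ^ 2 + 2 * C c * X + C d := by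
  simp only [derivative_add, derivative_C_mul, derivative_X_pow, derivative_X, derivative_C]
  simp only [map_natCast]
  push_cast
  ring

theorem derivative_famCubic : derivative (famCubic k) = 3 * X ^ 2 + 6 * X + 3 * C X := by
  have h : famCubic k = C 0 * X ^ 4 + C 1 * X ^ 3 + C 3 * X ^ 2 + C (3 * X) * X + C X := by
    simp only [famCubic, C_mul, map_ofNat, C_0, C_1]; ring
  rw [h, derivative_quartic]
  simp only [C_mul, map_ofNat, C_0, C_1]
  ring

/-- The Picard–Fuchs equation for the Hasse invariant. -/
theorem th0_th0_hassePoly {p m : ℕ} [CharP k p] (hp : 5 ≤ p) (hm : 2 * m + 1 = p)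
    (h2 : (144 : k) ≠ 0) :
    th0 (th0 (hassePoly k m)) = sig k * hassePoly k m := by
  obtain ⟨n, rfl⟩ : ∃ n, m = n + 2 := ⟨m - 2, by omega⟩
  have hchar : (2 * (n : k[X][X]) + 5) = 0 := by
    have h : ((p : ℕ) : k[X][X]) = 0 := CharP.cast_eq_zero _ _
    rw [← hm] at h
    push_cast at h
    linear_combination h
  set Q : k[X][X] := (31 - 27 * C X) * X ^ 4 + (124 - 108 * C X) * X ^ 3 +
    (99 - 48 * C X - 27 * C X ^ 2) * X ^ 2 + (18 + 16 * C X - 18 * C X ^ 2) * X +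
      (7 * C X - 3 * C X ^ 2) with hQ
  have hQ' : derivative Q = 4 * (31 - 27 * C X) * X ^ 3 + 3 * (124 - 108 * C X) * X ^ 2 +
      2 * (99 - 48 * C X - 27 * C X ^ 2) * X + (18 + 16 * C X - 18 * C X ^ 2) := by
    have h : Q = C (31 - 27 * X) * X ^ 4 + C (124 - 108 * X) * X ^ 3 +
        C (99 - 48 * X - 27 * X ^ 2) * X ^ 2 + C (18 + 16 * X - 18 * X ^ 2) * X +
          C (7 * X - 3 * X ^ 2) := by
      simp only [hQ, C_mul, C_sub, C_add, C_pow, map_ofNat]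
    rw [h, derivative_quartic]
    simp only [C_mul, C_sub, C_add, C_pow, map_ofNat]
  have key : (144 : k[X][X]) * th0.onCoeff (th0.onCoeff (famCubic k ^ (n + 2))) =
      C (X * (31 - 27 * X)) * famCubic k ^ (n + 2) +
        C (2 * X) * derivative (Q * famCubic k ^ (n + 1)) := by
    have hid := picardFuchs_identity (A := k[X][X]) (C X) X n hchar _ _ _ _ _ _ rfl
      onCoeff_famCubic onCoeff_onCoeff_famCubic derivative_famCubic hQ hQ'
    have hc : th0.onCoeff ((n + 2 : ℕ) : k[X][X]) = 0 := (th0.onCoeff).map_natCast _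
    simp only [Derivation.leibniz_pow, Derivation.leibniz, smul_eq_mul, nsmul_eq_mul,
      derivative_mul, derivative_pow, C_mul, C_sub, map_ofNat, map_natCast,
      show n + 2 - 1 = n + 1 by omega, show n + 1 - 1 = n by omega, hc]
    push_cast
    change _ = C X * (31 - 27 * C X) * famCubic k ^ (n + 2) + _
    rw [show (X ^ 3 + 3 * X ^ 2 + C X * (3 * X + 1) : k[X][X]) = famCubic k from rfl] at hid
    linear_combination (famCubic k ^ n) * hid
  have h := congrArg (fun F => F.coeff (2 * (n + 2))) key
  simp only [coeff_add, coeff_C_mul, coeff_derivative, Derivation.coeff_onCoeff,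
    ← map_ofNat (C : k[X] →+* k[X][X]) 144] at h
  have hz : ((2 * (n + 2) : ℕ) : k[X]) + 1 = 0 := by
    have h : ((p : ℕ) : k[X]) = 0 := CharP.cast_eq_zero _ _
    rw [← hm] at h
    exact_mod_cast h
  rw [hz, mul_zero, mul_zero, add_zero] at h
  have h144 : (C (1 / 144 : k) * 144 : k[X]) = 1 := by
    rw [← map_ofNat (C : k →+* k[X]) 144, ← C_mul, one_div, inv_mul_cancel₀ h2, C_1]
  change th0 (th0 ((famCubic k ^ (n + 2)).coeff (2 * (n + 2)))) =
    C (1 / 144) * (X * (31 - 27 * X)) * (famCubic k ^ (n + 2)).coeff (2 * (n + 2))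
  linear_combination C (1 / 144 : k) * h -
    th0 (th0 ((famCubic k ^ (n + 2)).coeff (2 * (n + 2)))) * h144

end Hasse

end LinSys

namespace LinSys

section Trace

variable {p : ℕ} [Fact p.Prime]

theorem sum_zmod_pow {i : ℕ} (hi : i < 2 * (p - 1)) :
    ∑ x : ZMod p, x ^ i = if i = p - 1 then -1 else 0 := by
  have hp : p.Prime := Fact.out
  have h2 := hp.two_le
  split_ifs with h
  · subst h
    have h1 : ∀ x : ZMod p, x ^ (p - 1) = if x = 0 then 0 else 1 := fun x => by
      split_ifs with hx
      · rw [hx, zero_pow (by omega)]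
      · exact ZMod.pow_card_sub_one_eq_one hx
    simp only [h1]
    have h3 : ∀ x : ZMod p, (if x = 0 then (0 : ZMod p) else 1) = 1 - if x = 0 then 1 else 0 :=
      fun x => by split_ifs <;> simp
    simp [h3]
  · rcases lt_or_gt_of_ne h with h' | h'
    · exact FiniteField.sum_pow_lt_card_sub_one _ _ (by rwa [ZMod.card])
    · have h1 : ∀ x : ZMod p, x ^ i = x ^ (i - (p - 1)) := fun x => by
        rcases eq_or_ne x 0 with rfl | hx
        · rw [zero_pow (by omega), zero_pow (by omega)]
        · conv_lhs => rw [show i = (p - 1) + (i - (p - 1)) by omega, pow_add,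
            ZMod.pow_card_sub_one_eq_one hx, one_mul]
      simp only [h1]
      exact FiniteField.sum_pow_lt_card_sub_one _ _ (by rw [ZMod.card]; omega)

theorem sum_eval_eq_neg_coeff {F : (ZMod p)[X]} (hF : F.natDegree < 2 * (p - 1)) :
    ∑ x : ZMod p, F.eval x = -F.coeff (p - 1) := by
  simp only [eval_eq_sum_range' hF]
  rw [sum_comm, sum_congr rfl fun i hi => by rw [← mul_sum, sum_zmod_pow (mem_range.1 hi)]]
  have h2 := (Fact.out : p.Prime).two_le
  simp only [mul_ite, mul_neg, mul_one, mul_zero]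
  rw [sum_ite_eq', if_pos (by rw [mem_range]; omega)]

theorem sum_cubic_pow (hp2 : p ≠ 2) (s : ZMod p) :
    ∑ x : ZMod p, (x ^ 3 + 3 * x ^ 2 + s * (3 * x + 1)) ^ (p / 2) =
      -(hassePoly (ZMod p) (p / 2)).eval s := by
  have hp : p.Prime := Fact.out
  have h2 := hp.two_le
  have hodd := hp.eq_two_or_odd.resolve_left hp2
  have hdeg : ((X ^ 3 + 3 * X ^ 2 + C s * (3 * X + 1) : (ZMod p)[X]) ^ (p / 2)).natDegree <
      2 * (p - 1) := by
    have h3 : (X ^ 3 + 3 * X ^ 2 + C s * (3 * X + 1) : (ZMod p)[X]).natDegree ≤ 3 := by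
      compute_degree
    refine (natDegree_pow_le_of_le (p / 2) h3).trans_lt ?_
    omega
  have h := sum_eval_eq_neg_coeff hdeg
  rw [eval_hassePoly, show 2 * (p / 2) = p - 1 by omega, ← h]
  refine sum_congr rfl fun x _ => ?_
  simp

theorem card_sqrts (hp2 : p ≠ 2) (c : ZMod p) :
    ((Nat.card {y : ZMod p // y ^ 2 = c} : ℕ) : ZMod p) = c ^ (p / 2) + 1 := by
  have hchar : ringChar (ZMod p) ≠ 2 := by rwa [ZMod.ringChar_zmod_n]
  have h1 := quadraticChar_card_sqrts hchar c
  have h2 := quadraticChar_eq_pow_of_char_ne_two' hchar c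
  rw [ZMod.card] at h2
  rw [← h2]
  have h3 : Nat.card {y : ZMod p // y ^ 2 = c} = {x : ZMod p | x ^ 2 = c}.toFinset.card := by
    rw [Nat.card_eq_fintype_card, Set.toFinset_card]
    exact Fintype.card_congr (Equiv.refl _)
  rw [h3]
  exact_mod_cast congrArg (Int.cast (R := ZMod p)) h1

theorem frobTrace_cast (hp2 : p ≠ 2) (A B : ZMod p) :
    ((frobTrace p A B : ℤ) : ZMod p) = -∑ x : ZMod p, (x ^ 3 + A * x + B) ^ (p / 2) := by
  have h : Nat.card {P : ZMod p × ZMod p // P.2 ^ 2 = P.1 ^ 3 + A * P.1 + B} =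
      ∑ x : ZMod p, Nat.card {y : ZMod p // y ^ 2 = x ^ 3 + A * x + B} := by
    rw [← Nat.card_sigma]
    refine Nat.card_congr ⟨fun P => ⟨P.1.1, P.1.2, P.2⟩, fun P => ⟨(P.1, P.2.1), P.2.2⟩, ?_, ?_⟩
    · intro P; rfl
    · intro P; rfl
  rw [frobTrace, numPoints, h]
  push_cast
  simp only [card_sqrts hp2, sum_add_distrib]
  simp

/-- The trace of an elliptic curve with `j ≠ 0, 1728` is a value of the Hasse polynomial,
up to sign. -/
theorem eval_hassePoly_eq_frobTrace (hp : 5 ≤ p) {A B : ZMod p} (hA : A ≠ 0) (hB : B ≠ 0)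
    {s : ZMod p} (hs : s * (27 * B ^ 2) = 4 * A ^ 3 + 27 * B ^ 2) :
    (hassePoly (ZMod p) (p / 2)).eval s = (frobTrace p A B : ℤ) ∨
      (hassePoly (ZMod p) (p / 2)).eval s = -(frobTrace p A B : ℤ) := by
  have hpp : p.Prime := Fact.out
  have h2 : (2 : ZMod p) ≠ 0 := by
    exact_mod_cast natCast_ne_zero_of_lt (k := ZMod p) (p := p) two_ne_zero (by omega)
  have h3 : (3 : ZMod p) ≠ 0 := by
    exact_mod_cast natCast_ne_zero_of_lt (k := ZMod p) (p := p) three_ne_zero (by omega)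
  have h27 : (27 : ZMod p) ≠ 0 := by
    rw [show (27 : ZMod p) = 3 ^ 3 by norm_num]; exact pow_ne_zero _ h3
  set μ : ZMod p := -3 * B / (2 * A) with hμ
  have hμ0 : μ ≠ 0 := div_ne_zero (mul_ne_zero (neg_ne_zero.2 h3) hB) (mul_ne_zero h2 hA)
  have hs' : s = (4 * A ^ 3 + 27 * B ^ 2) / (27 * B ^ 2) := by
    rw [eq_div_iff (mul_ne_zero h27 (pow_ne_zero _ hB)), hs]
  have hid : ∀ y : ZMod p, (μ * (y + 1)) ^ 3 + A * (μ * (y + 1)) + B =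
      μ ^ 3 * (y ^ 3 + 3 * y ^ 2 + s * (3 * y + 1)) := fun y => by
    rw [hs', hμ]
    field_simp
    ring
  have hbij : Function.Bijective fun y : ZMod p => μ * (y + 1) := by
    rw [← Finite.injective_iff_bijective]
    intro x y h
    exact add_right_cancel (mul_left_cancel₀ hμ0 h)
  have hsum := hbij.sum_comp fun x => (x ^ 3 + A * x + B) ^ (p / 2)
  simp only [hid] at hsum
  simp only [mul_pow (μ ^ 3), ← mul_sum, sum_cubic_pow (by omega : p ≠ 2)] at hsum
  have hpow : (μ ^ 3) ^ (p / 2) = 1 ∨ (μ ^ 3) ^ (p / 2) = -1 :=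
    ZMod.pow_div_two_eq_neg_one_or_one p (pow_ne_zero _ hμ0)
  rw [frobTrace_cast (by omega : p ≠ 2), ← hsum]
  rcases hpow with h | h <;> rw [h] <;> simp

theorem picardFuchs_data (hp : 5 ≤ p) :
    th0 (th0 (hassePoly (ZMod p) (p / 2))) = sig (ZMod p) * hassePoly (ZMod p) (p / 2) ∧
      (hassePoly (ZMod p) (p / 2)).eval 0 ≠ 0 ∧ (hassePoly (ZMod p) (p / 2)).natDegree ≤ p ∧
      (th0 (hassePoly (ZMod p) (p / 2))).natDegree ≤ p := by
  have hpp : p.Prime := Fact.out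
  have hodd := hpp.eq_two_or_odd.resolve_left (by omega)
  have h2 : (2 : ZMod p) ≠ 0 := by
    exact_mod_cast natCast_ne_zero_of_lt (k := ZMod p) (p := p) two_ne_zero (by omega)
  have h3 : (3 : ZMod p) ≠ 0 := by
    exact_mod_cast natCast_ne_zero_of_lt (k := ZMod p) (p := p) three_ne_zero (by omega)
  have h144 : (144 : ZMod p) ≠ 0 := by
    rw [show (144 : ZMod p) = 2 ^ 4 * 3 ^ 2 by norm_num]
    exact mul_ne_zero (pow_ne_zero _ h2) (pow_ne_zero _ h3)
  have hdeg := natDegree_hassePoly_le (k := ZMod p) (p / 2)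
  refine ⟨th0_th0_hassePoly hp (by omega) h144, ?_, by omega, ?_⟩
  · rw [eval_zero_hassePoly]
    exact pow_ne_zero _ h3
  · have := natDegree_th0_le (hassePoly (ZMod p) (p / 2))
    omega

/-- The points of `𝔽_p` outside `{0, 1}` at which the Hasse polynomial takes the value `a`. -/
def hasseLevel (p : ℕ) [Fact p.Prime] (a : ZMod p) : Finset (ZMod p) :=
  univ.filter fun x => x ≠ 0 ∧ x ≠ 1 ∧ (hassePoly (ZMod p) (p / 2)).eval x = a

theorem mem_hasseLevel {a x : ZMod p} : x ∈ hasseLevel p a ↔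
    x ≠ 0 ∧ x ≠ 1 ∧ (hassePoly (ZMod p) (p / 2)).eval x = a := by
  simp [hasseLevel]

theorem card_hasseLevel_le_char (a : ZMod p) : (hasseLevel p a).card ≤ p :=
  (card_le_univ _).trans (ZMod.card p).le

theorem card_hasseLevel_le (hp : 5 ≤ p) (a : ZMod p) :
    ((hasseLevel p a).card : ℝ) ≤ 97 * (p : ℝ) ^ (3 / 4 : ℝ) := by
  obtain ⟨h1, h2, h3, h4⟩ := picardFuchs_data hp
  have hp0 : (0 : ℝ) ≤ p := Nat.cast_nonneg p
  set y : ℝ := (p : ℝ) ^ (1 / 4 : ℝ) with hy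
  have hy4 : y ^ 4 = p := by rw [hy, ← Real.rpow_natCast, ← Real.rpow_mul hp0]; norm_num
  have hy3 : (p : ℝ) ^ (3 / 4 : ℝ) = y ^ 3 := by
    rw [hy, ← Real.rpow_natCast, ← Real.rpow_mul hp0]; norm_num
  have hy0 : 0 ≤ y := Real.rpow_nonneg hp0 _
  rw [hy3]
  rcases lt_or_ge y 8 with hy8 | hy8
  · have h5 : ((hasseLevel p a).card : ℝ) ≤ p := by exact_mod_cast card_hasseLevel_le_char a
    rw [← hy4] at h5
    nlinarith [pow_nonneg hy0 3, mul_le_mul_of_nonneg_left hy8.le (pow_nonneg hy0 3)]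
  · set q : ℕ := ⌊y / 8⌋₊ with hq
    have hq1 : (q : ℝ) ≤ y / 8 := Nat.floor_le (by positivity)
    have hq2 : y / 16 ≤ q := by
      have h6 := Nat.lt_floor_add_one (y / 8)
      have h7 : (1 : ℝ) ≤ q := by
        have : 1 ≤ q := Nat.le_floor (by push_cast; linarith)
        exact_mod_cast this
      rw [← hq] at h6
      linarith
    have hq0 : (0 : ℝ) < q := by linarith
    have hqp : 3000 * q ^ 4 ≤ p := by
      have h8 : (3000 : ℝ) * q ^ 4 ≤ p := by
        rw [← hy4]
        have : (q : ℝ) ^ 4 ≤ (y / 8) ^ 4 := by gcongr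
        nlinarith [pow_nonneg hy0 4]
      exact_mod_cast h8
    have h9 := card_level_mul_le_general hp rfl h1 h2 h3 h4 (Nat.cast_pos.1 hq0) hqp a
      (hasseLevel p a) fun x hx => ⟨ZMod.pow_card x, mem_hasseLevel.1 hx⟩
    have h10 : ((hasseLevel p a).card : ℝ) * q ^ 2 ≤ 6 * p * q + q ^ 2 := by exact_mod_cast h9
    have h11 : ((hasseLevel p a).card : ℝ) * q ≤ 6 * p + q := by
      refine le_of_mul_le_mul_right ?_ hq0
      linarith
    have h12 : (1 : ℝ) ≤ y ^ 3 := one_le_pow₀ (by linarith)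
    refine le_of_mul_le_mul_right (h11.trans ?_) hq0
    rw [← hy4]
    nlinarith [mul_le_mul_of_nonneg_left hq2 (pow_nonneg hy0 3)]

theorem card_hasseLevel_zero_le (hp : 5 ≤ p) :
    ((hasseLevel p 0).card : ℝ) ≤ 97 * (p : ℝ) ^ (2 / 3 : ℝ) := by
  obtain ⟨h1, h2, h3, h4⟩ := picardFuchs_data hp
  have hp0 : (0 : ℝ) ≤ p := Nat.cast_nonneg p
  set y : ℝ := (p : ℝ) ^ (1 / 3 : ℝ) with hy
  have hy4 : y ^ 3 = p := by rw [hy, ← Real.rpow_natCast, ← Real.rpow_mul hp0]; norm_num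
  have hy3 : (p : ℝ) ^ (2 / 3 : ℝ) = y ^ 2 := by
    rw [hy, ← Real.rpow_natCast, ← Real.rpow_mul hp0]; norm_num
  have hy0 : 0 ≤ y := Real.rpow_nonneg hp0 _
  rw [hy3]
  rcases lt_or_ge y 8 with hy8 | hy8
  · have h5 : ((hasseLevel p 0).card : ℝ) ≤ p := by exact_mod_cast card_hasseLevel_le_char 0
    rw [← hy4] at h5
    nlinarith [pow_nonneg hy0 2, mul_le_mul_of_nonneg_left hy8.le (pow_nonneg hy0 2)]
  · set q : ℕ := ⌊y / 8⌋₊ with hq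
    have hq1 : (q : ℝ) ≤ y / 8 := Nat.floor_le (by positivity)
    have hq2 : y / 16 ≤ q := by
      have h6 := Nat.lt_floor_add_one (y / 8)
      have h7 : (1 : ℝ) ≤ q := by
        have : 1 ≤ q := Nat.le_floor (by push_cast; linarith)
        exact_mod_cast this
      rw [← hq] at h6
      linarith
    have hq0 : (0 : ℝ) < q := by linarith
    have hqp : 400 * q ^ 3 ≤ p := by
      have h8 : (400 : ℝ) * q ^ 3 ≤ p := by
        rw [← hy4]
        have : (q : ℝ) ^ 3 ≤ (y / 8) ^ 3 := by gcongr
        nlinarith [pow_nonneg hy0 3]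
      exact_mod_cast h8
    have h9 := card_level_mul_le_zero hp rfl h1 h2 h3 h4 (Nat.cast_pos.1 hq0) hqp
      (hasseLevel p 0) fun x hx => ⟨ZMod.pow_card x, mem_hasseLevel.1 hx⟩
    have h10 : ((hasseLevel p 0).card : ℝ) * q ^ 2 ≤ 4 * p * q + q ^ 2 := by exact_mod_cast h9
    have h11 : ((hasseLevel p 0).card : ℝ) * q ≤ 4 * p + q := by
      refine le_of_mul_le_mul_right ?_ hq0
      linarith
    have h12 : (1 : ℝ) ≤ y ^ 2 := one_le_pow₀ (by linarith)
    refine le_of_mul_le_mul_right (h11.trans ?_) hq0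
    rw [← hy4]
    nlinarith [mul_le_mul_of_nonneg_left hq2 (pow_nonneg hy0 2)]

end Trace

end LinSys

namespace LinSys

section Reduction

/-- Reduction modulo `p` of an integer polynomial. -/
def redPoly (p : ℕ) (f : ℤ[X]) : (ZMod p)[X] := f.map (Int.castRingHom (ZMod p))

theorem coeff_redPoly (p : ℕ) (f : ℤ[X]) (n : ℕ) :
    (redPoly p f).coeff n = (f.coeff n : ZMod p) := by
  simp [redPoly]

theorem redPoly_pow (p : ℕ) (f : ℤ[X]) (n : ℕ) : redPoly p (f ^ n) = redPoly p f ^ n := by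
  simp [redPoly]

theorem natDegree_redPoly_le (p : ℕ) (f : ℤ[X]) : (redPoly p f).natDegree ≤ f.natDegree :=
  natDegree_map_le

theorem eval_redPoly_Dpoly (p : ℕ) (f g : ℤ[X]) (w : ZMod p) :
    (redPoly p (Dpoly f g)).eval w =
      -16 * (4 * (redPoly p f).eval w ^ 3 + 27 * (redPoly p g).eval w ^ 2) := by
  simp [redPoly, Dpoly]

/-- A nonconstant `j`-invariant forces `f³` and `g²` to be linearly independent. -/
theorem exists_minor_ne_zero {f g : ℤ[X]} (hfg : Nondeg f g) : ∃ i j,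
    (f ^ 3).coeff i * (g ^ 2).coeff j - (f ^ 3).coeff j * (g ^ 2).coeff i ≠ 0 := by
  by_contra! h
  obtain ⟨hD, hj⟩ := hfg
  set P := f ^ 3 with hP
  set Q := g ^ 2 with hQ
  have hD' : C 4 * P + C 27 * Q ≠ 0 := fun h0 => hD (by
    rw [Dpoly, ← hP, ← hQ]
    simp only [map_ofNat] at h0
    rw [h0, mul_zero])
  obtain ⟨i, hi⟩ : ∃ i, (C 4 * P + C 27 * Q).coeff i ≠ 0 := by
    by_contra! h0
    exact hD' (Polynomial.ext fun i => by rw [h0 i, coeff_zero])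
  have hprop : C ((C 4 * P + C 27 * Q).coeff i) * P = C (P.coeff i) * (C 4 * P + C 27 * Q) := by
    ext j
    simp only [coeff_C_mul, coeff_add]
    linear_combination (-27) * h i j
  set e : ℤ := (C 4 * P + C 27 * Q).coeff i with he
  refine hj ⟨6912 * (P.coeff i : ℚ) / e, ?_⟩
  have hq := congrArg (Polynomial.map (Int.castRingHom ℚ)) hprop
  have he0 : (e : ℚ) ≠ 0 := by exact_mod_cast hi
  have hce : (C (e : ℚ) : ℚ[X]) ≠ 0 := C_ne_zero.2 he0
  refine mul_left_cancel₀ hce ?_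
  rw [← mul_assoc (C (e : ℚ)) (C _), ← C_mul, mul_div_cancel₀ _ he0]
  simp only [Dpoly, hP, hQ, Polynomial.map_mul, Polynomial.map_add, Polynomial.map_pow, map_intCast,
    eq_intCast, Polynomial.map_intCast, map_ofNat, C_mul, Polynomial.map_neg,
    Polynomial.map_ofNat] at hq ⊢
  linear_combination (-110592) * hq

theorem exists_forall_prime_independent {f g : ℤ[X]} (hfg : Nondeg f g) : ∃ P₀ : ℕ, 5 ≤ P₀ ∧
    ∀ p : ℕ, p.Prime → P₀ ≤ p → ∀ c₁ c₂ : ZMod p,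
      C c₁ * redPoly p f ^ 3 + C c₂ * redPoly p g ^ 2 = 0 → c₁ = 0 ∧ c₂ = 0 := by
  obtain ⟨i, j, hM⟩ := exists_minor_ne_zero hfg
  set M := (f ^ 3).coeff i * (g ^ 2).coeff j - (f ^ 3).coeff j * (g ^ 2).coeff i with hMdef
  refine ⟨max 5 (M.natAbs + 1), le_max_left _ _, fun p hp hpP c₁ c₂ h => ?_⟩
  have := Fact.mk hp
  have hMp : (M : ZMod p) ≠ 0 := fun h0 => by
    rw [ZMod.intCast_zmod_eq_zero_iff_dvd] at h0
    have h1 := Nat.le_of_dvd (Int.natAbs_pos.2 hM) (Int.natCast_dvd.1 h0)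
    have h2 := le_max_right 5 (M.natAbs + 1)
    omega
  have hcoeff : ∀ n, c₁ * ((f ^ 3).coeff n : ZMod p) + c₂ * ((g ^ 2).coeff n : ZMod p) = 0 :=
    fun n => by
      have := congrArg (fun q => q.coeff n) h
      simpa only [← redPoly_pow, coeff_add, coeff_C_mul, coeff_redPoly, coeff_zero] using this
  have hMe : (M : ZMod p) =
      (f ^ 3).coeff i * (g ^ 2).coeff j - (f ^ 3).coeff j * (g ^ 2).coeff i := by
    rw [hMdef]; push_cast; ring
  constructor
  · refine (mul_eq_zero.1 (?_ : (M : ZMod p) * c₁ = 0)).resolve_left hMp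
    rw [hMe]
    linear_combination ((g ^ 2).coeff j : ZMod p) * hcoeff i - ((g ^ 2).coeff i : ZMod p) * hcoeff j
  · refine (mul_eq_zero.1 (?_ : (M : ZMod p) * c₂ = 0)).resolve_left hMp
    rw [hMe]
    linear_combination ((f ^ 3).coeff i : ZMod p) * hcoeff j - ((f ^ 3).coeff j : ZMod p) * hcoeff i

/-- The parameters `w` modulo `p` for which the curve has good reduction and trace `a`. -/
def traceLevel (f g : ℤ[X]) (p : ℕ) [Fact p.Prime] (a : ℤ) : Finset (ZMod p) :=
  univ.filter fun w => (redPoly p (Dpoly f g)).eval w ≠ 0 ∧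
    frobTrace p ((redPoly p f).eval w) ((redPoly p g).eval w) = a

theorem card_roots_toFinset_le {K : Type*} [Field K] [DecidableEq K] (q : K[X]) :
    q.roots.toFinset.card ≤ q.natDegree :=
  (Multiset.toFinset_card_le _).trans (card_roots' q)

theorem card_traceLevel_le {f g : ℤ[X]} {p : ℕ} [Fact p.Prime] (hp : 5 ≤ p)
    (hind : ∀ c₁ c₂ : ZMod p, C c₁ * redPoly p f ^ 3 + C c₂ * redPoly p g ^ 2 = 0 →
      c₁ = 0 ∧ c₂ = 0) (a : ℤ) :
    (traceLevel f g p a).card ≤ 3 * (f.natDegree + g.natDegree) *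
      (1 + (hasseLevel p (a : ZMod p)).card + (hasseLevel p (-a : ZMod p)).card) := by
  have h2 : (2 : ZMod p) ≠ 0 := by
    exact_mod_cast natCast_ne_zero_of_lt (k := ZMod p) (p := p) two_ne_zero (by omega)
  have h3 : (3 : ZMod p) ≠ 0 := by
    exact_mod_cast natCast_ne_zero_of_lt (k := ZMod p) (p := p) three_ne_zero (by omega)
  have h4 : (4 : ZMod p) ≠ 0 := by
    rw [show (4 : ZMod p) = 2 ^ 2 by norm_num]
    exact pow_ne_zero _ h2
  have h27 : (27 : ZMod p) ≠ 0 := by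
    rw [show (27 : ZMod p) = 3 ^ 3 by norm_num]
    exact pow_ne_zero _ h3
  have hf : redPoly p f ≠ 0 := fun h => one_ne_zero (hind 1 0 (by simp [h])).1
  have hg : redPoly p g ≠ 0 := fun h => one_ne_zero (hind 0 1 (by simp [h])).2
  set r : ZMod p → (ZMod p)[X] := fun s =>
    C 4 * redPoly p f ^ 3 + C (27 * (1 - s)) * redPoly p g ^ 2 with hr
  have hr0 : ∀ s, r s ≠ 0 := fun s h => h4 (hind _ _ h).1
  have hrdeg : ∀ s, (r s).natDegree ≤ 3 * (f.natDegree + g.natDegree) := fun s => by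
    have h5 := natDegree_redPoly_le p f
    have h6 := natDegree_redPoly_le p g
    refine natDegree_add_le_of_degree_le ((natDegree_C_mul_le _ _).trans ?_)
      ((natDegree_C_mul_le _ _).trans ?_)
    · exact (natDegree_pow_le_of_le 3 h5).trans (by omega)
    · exact (natDegree_pow_le_of_le 2 h6).trans (by omega)
  have hsub : traceLevel f g p a ⊆ ((redPoly p f).roots.toFinset ∪ (redPoly p g).roots.toFinset) ∪
      (hasseLevel p (a : ZMod p) ∪ hasseLevel p (-a : ZMod p)).biUnion
        fun s => (r s).roots.toFinset := fun w hw => by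
    obtain ⟨hΔ, htr⟩ := (mem_filter.1 hw).2
    rw [mem_union, mem_union, Multiset.mem_toFinset, Multiset.mem_toFinset, mem_roots hf,
      mem_roots hg]
    by_cases hA : (redPoly p f).eval w = 0
    · exact Or.inl (Or.inl hA)
    by_cases hB : (redPoly p g).eval w = 0
    · exact Or.inl (Or.inr hB)
    refine Or.inr ?_
    rw [eval_redPoly_Dpoly] at hΔ
    set A := (redPoly p f).eval w with hAdef
    set B := (redPoly p g).eval w with hBdef
    have hden : 27 * B ^ 2 ≠ 0 := mul_ne_zero h27 (pow_ne_zero _ hB)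
    set s := (4 * A ^ 3 + 27 * B ^ 2) / (27 * B ^ 2) with hs
    have hs' : s * (27 * B ^ 2) = 4 * A ^ 3 + 27 * B ^ 2 := div_mul_cancel₀ _ hden
    have hs0 : s ≠ 0 := fun h => by
      rw [h, zero_mul] at hs'
      exact hΔ (by rw [← hs', mul_zero])
    have hs1 : s ≠ 1 := fun h => by
      rw [h, one_mul] at hs'
      exact mul_ne_zero h4 (pow_ne_zero 3 hA) (by linear_combination -hs')
    refine mem_biUnion.2 ⟨s, ?_, ?_⟩
    · rw [mem_union, mem_hasseLevel, mem_hasseLevel, ← htr]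
      rcases eval_hassePoly_eq_frobTrace hp hA hB hs' with h | h
      · exact Or.inl ⟨hs0, hs1, h⟩
      · exact Or.inr ⟨hs0, hs1, h⟩
    · rw [Multiset.mem_toFinset, mem_roots (hr0 s), IsRoot.def, hr]
      simp only [eval_add, eval_mul, eval_pow, eval_C, ← hAdef, ← hBdef]
      linear_combination -hs'
  refine (card_le_card hsub).trans ((card_union_le _ _).trans ?_)
  have h7 : ((redPoly p f).roots.toFinset ∪ (redPoly p g).roots.toFinset).card ≤
      3 * (f.natDegree + g.natDegree) := by
    have h5 := (card_roots_toFinset_le _).trans (natDegree_redPoly_le p f)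
    have h6 := (card_roots_toFinset_le _).trans (natDegree_redPoly_le p g)
    exact (card_union_le _ _).trans (by omega)
  have h8 := card_biUnion_le_card_mul (hasseLevel p (a : ZMod p) ∪ hasseLevel p (-a : ZMod p))
    (fun s => (r s).roots.toFinset) _ fun s _ => (card_roots_toFinset_le _).trans (hrdeg s)
  have h9 := Nat.mul_le_mul_right (3 * (f.natDegree + g.natDegree))
    (card_union_le (hasseLevel p (a : ZMod p)) (hasseLevel p (-a : ZMod p)))
  nlinarith

end Reduction

end LinSys

namespace LinSys

section Average

theorem exists_card_traceLevel_le {f g : ℤ[X]} (hfg : Nondeg f g) :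
    ∃ (P₀ : ℕ) (C₀ : ℝ), 1 ≤ C₀ ∧ ∀ p : ℕ, ∀ _ : Fact p.Prime, P₀ ≤ p →
      (∀ a, ((traceLevel f g p a).card : ℝ) ≤ C₀ * (p : ℝ) ^ (3 / 4 : ℝ)) ∧
        ((traceLevel f g p 0).card : ℝ) ≤ C₀ * (p : ℝ) ^ (2 / 3 : ℝ) := by
  obtain ⟨P₀, hP₀, hind⟩ := exists_forall_prime_independent hfg
  set d : ℝ := f.natDegree + g.natDegree with hd
  have hd0 : 0 ≤ d := by positivity
  refine ⟨P₀, 585 * d + 1, by linarith, fun p hp hpP => ?_⟩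
  have hp5 : 5 ≤ p := hP₀.trans hpP
  have hp1 : (1 : ℝ) ≤ p := by exact_mod_cast hp.out.one_le
  have hbound : ∀ (a : ℤ) (e : ℝ), 0 ≤ e →
      ((hasseLevel p (a : ZMod p)).card : ℝ) ≤ 97 * (p : ℝ) ^ e →
      ((hasseLevel p (-a : ZMod p)).card : ℝ) ≤ 97 * (p : ℝ) ^ e →
      ((traceLevel f g p a).card : ℝ) ≤ (585 * d + 1) * (p : ℝ) ^ e := fun a e he h1 h2 => by
    have h3 : ((traceLevel f g p a).card : ℝ) ≤ 3 * d *
        (1 + (hasseLevel p (a : ZMod p)).card + (hasseLevel p (-a : ZMod p)).card) := by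
      have h := (Nat.cast_le (α := ℝ)).2 (card_traceLevel_le hp5 (hind p hp.out hpP) a)
      push_cast at h
      exact h
    have h4 : (1 : ℝ) ≤ (p : ℝ) ^ e := Real.one_le_rpow hp1 he
    calc _ ≤ _ := h3
      _ ≤ 3 * d * ((p : ℝ) ^ e + 97 * (p : ℝ) ^ e + 97 * (p : ℝ) ^ e) := by gcongr
      _ ≤ _ := by linarith
  refine ⟨fun a => hbound a _ (by norm_num) (card_hasseLevel_le hp5 _) (card_hasseLevel_le hp5 _),
    hbound 0 _ (by norm_num) ?_ ?_⟩
  · simpa using card_hasseLevel_zero_le hp5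
  · simpa using card_hasseLevel_zero_le hp5

theorem card_le_of_separated {ι : Type*} (S : Finset ι) (n d : ι → ℤ) {T P : ℝ} (hP : 0 < P)
    (h0 : ∀ i ∈ S, 0 ≤ n i ∧ n i ≤ d i ∧ 0 < d i ∧ (d i : ℝ) ≤ T)
    (hsep : ∀ i ∈ S, ∀ j ∈ S, i ≠ j → P ≤ |(n i * d j - n j * d i : ℝ)|) :
    (S.card : ℝ) ≤ T ^ 2 / P + 1 := by
  have hmap : ∀ i ∈ S, ⌊(n i : ℝ) / d i * (T ^ 2 / P)⌋₊ ∈ range (⌊T ^ 2 / P⌋₊ + 1) := fun i hi => by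
    obtain ⟨h1, h2, h3, h4⟩ := h0 i hi
    rw [mem_range, Nat.lt_succ_iff]
    refine Nat.floor_mono (mul_le_of_le_one_left (by positivity) ?_)
    rw [div_le_one (by exact_mod_cast h3)]
    exact_mod_cast h2
  have hinj : Set.InjOn (fun i => ⌊(n i : ℝ) / d i * (T ^ 2 / P)⌋₊) S := fun i hi j hj hij => by
    by_contra hne
    obtain ⟨h1, h2, h3, h4⟩ := h0 i hi
    obtain ⟨k1, k2, k3, k4⟩ := h0 j hj
    have hdi : (0 : ℝ) < d i := by exact_mod_cast h3
    have hdj : (0 : ℝ) < d j := by exact_mod_cast k3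
    have hni : (0 : ℝ) ≤ n i := by exact_mod_cast h1
    have hnj : (0 : ℝ) ≤ n j := by exact_mod_cast k1
    have h5 : |(n i : ℝ) / d i * (T ^ 2 / P) - n j / d j * (T ^ 2 / P)| < 1 := by
      have e1 := Nat.floor_le (show 0 ≤ (n i : ℝ) / d i * (T ^ 2 / P) by positivity)
      have e2 := Nat.lt_floor_add_one ((n i : ℝ) / d i * (T ^ 2 / P))
      have e3 := Nat.floor_le (show 0 ≤ (n j : ℝ) / d j * (T ^ 2 / P) by positivity)
      have e4 := Nat.lt_floor_add_one ((n j : ℝ) / d j * (T ^ 2 / P))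
      simp only at hij
      rw [← hij] at e3 e4
      rw [abs_lt]
      constructor <;> linarith
    have h6 : (n i : ℝ) / d i * (T ^ 2 / P) - n j / d j * (T ^ 2 / P) =
        (n i * d j - n j * d i) * (T ^ 2 / (P * (d i * d j))) := by
      field_simp
    rw [h6, abs_mul, abs_of_nonneg (show 0 ≤ T ^ 2 / (P * (d i * d j)) by positivity),
      ← mul_div_assoc, div_lt_one (by positivity)] at h5
    have h7 : P * (d i * d j) ≤ |(n i * d j - n j * d i : ℝ)| * T ^ 2 := by
      rw [sq T]
      have := hsep i hi j hj hne
      have hT0 : 0 ≤ T := hdi.le.trans h4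
      gcongr
    linarith
  have hcard := card_le_card_of_injOn _ hmap hinj
  rw [card_range] at hcard
  calc (S.card : ℝ) ≤ (⌊T ^ 2 / P⌋₊ + 1 : ℕ) := by exact_mod_cast hcard
    _ ≤ T ^ 2 / P + 1 := by
      push_cast
      have := Nat.floor_le (show 0 ≤ T ^ 2 / P by positivity)
      linarith

theorem mem_FT_bounds {T : ℝ} {t : ℚ} (ht : t ∈ FT T) :
    0 < t.num ∧ (t.num : ℝ) ≤ T ∧ (t.den : ℝ) ≤ T := by
  obtain ⟨⟨u, v⟩, hw, rfl⟩ := mem_image.1 ht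
  simp only [mem_filter, mem_product, mem_Icc] at hw
  obtain ⟨⟨⟨hu1, hu⟩, hv1, hv⟩, hgcd⟩ := hw
  have hv0 : 0 < v := by omega
  have hcop : u.natAbs.Coprime v.natAbs := hgcd
  have hT0 : ((⌊T⌋ : ℤ) : ℝ) ≤ T := Int.floor_le T
  have hnum : ((u : ℚ) / v).num = u := Rat.num_div_eq_of_coprime hv0 hcop
  have hden : ((((u : ℚ) / v).den : ℤ)) = v := Rat.den_div_eq_of_coprime hv0 hcop
  refine ⟨by rw [hnum]; omega, ?_, ?_⟩
  · rw [hnum]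
    exact le_trans (by exact_mod_cast hu) hT0
  · have : ((((u : ℚ) / v).den : ℤ) : ℝ) ≤ T := by
      rw [hden]
      exact le_trans (by exact_mod_cast hv) hT0
    exact_mod_cast this

theorem card_FT_le {T : ℝ} (hT : 1 ≤ T) : ((FT T).card : ℝ) ≤ T ^ 2 := by
  have h : (FT T).card ≤ ⌊T⌋.toNat * ⌊T⌋.toNat := by
    refine card_image_le.trans ((card_filter_le _ _).trans ?_)
    rw [card_product, Int.card_Icc]
    simp
  have h0 : ((⌊T⌋.toNat : ℕ) : ℝ) ≤ T := by
    have h1 : ((⌊T⌋.toNat : ℕ) : ℤ) = ⌊T⌋ := Int.toNat_of_nonneg (Int.floor_nonneg.2 (by linarith))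
    have h2 : ((⌊T⌋.toNat : ℕ) : ℝ) = (⌊T⌋ : ℤ) := by exact_mod_cast h1
    rw [h2]
    exact Int.floor_le T
  calc ((FT T).card : ℝ) ≤ (⌊T⌋.toNat : ℝ) * ⌊T⌋.toNat := by exact_mod_cast h
    _ ≤ T * T := by gcongr
    _ = T ^ 2 := (sq T).symm

theorem dvd_cross_of_redQ_eq {p : ℕ} [Fact p.Prime] {t₁ t₂ : ℚ} (h₁ : ¬p ∣ t₁.den)
    (h₂ : ¬p ∣ t₂.den) (h : redQ p t₁ = redQ p t₂) :
    (p : ℤ) ∣ t₁.num * t₂.den - t₂.num * t₁.den := by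
  rw [← ZMod.intCast_zmod_eq_zero_iff_dvd]
  have e₁ : ((t₁.den : ℕ) : ZMod p) ≠ 0 := fun h0 => h₁ ((ZMod.natCast_eq_zero_iff _ _).1 h0)
  have e₂ : ((t₂.den : ℕ) : ZMod p) ≠ 0 := fun h0 => h₂ ((ZMod.natCast_eq_zero_iff _ _).1 h0)
  rw [redQ, redQ, ← div_eq_mul_inv, ← div_eq_mul_inv, div_eq_div_iff e₁ e₂] at h
  push_cast
  rw [h, sub_self]

theorem card_FT_redQ_eq_le (T : ℝ) {p : ℕ} [Fact p.Prime] (s : ZMod p) :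
    (((FT T).filter fun t => ¬p ∣ t.den ∧ redQ p t = s).card : ℝ) ≤ 2 * (T ^ 2 / p) + 2 := by
  set S := (FT T).filter fun t => ¬p ∣ t.den ∧ redQ p t = s with hS
  have hp0 : (0 : ℝ) < p := by exact_mod_cast (Fact.out : p.Prime).pos
  have hb : ∀ t ∈ S, 0 < t.num ∧ (t.num : ℝ) ≤ T ∧ (t.den : ℝ) ≤ T := fun t ht =>
    mem_FT_bounds (mem_filter.1 ht).1
  have hsep : ∀ t₁ ∈ S, ∀ t₂ ∈ S, t₁ ≠ t₂ →
      (p : ℝ) ≤ |((t₁.num : ℝ) * ((t₂.den : ℤ) : ℝ) - t₂.num * ((t₁.den : ℤ) : ℝ))| :=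
    fun t₁ h₁ t₂ h₂ hne => by
      obtain ⟨-, h₁, h₁'⟩ := mem_filter.1 h₁
      obtain ⟨-, h₂, h₂'⟩ := mem_filter.1 h₂
      have hdvd := dvd_cross_of_redQ_eq h₁ h₂ (h₁'.trans h₂'.symm)
      have hne0 : t₁.num * t₂.den - t₂.num * t₁.den ≠ 0 := fun h0 =>
        hne (Rat.eq_iff_mul_eq_mul.2 (by linarith))
      have := Int.le_of_dvd (abs_pos.2 hne0) ((dvd_abs _ _).2 hdvd)
      exact_mod_cast this
  have h1 := card_le_of_separated (S.filter fun t => t.num ≤ (t.den : ℤ)) (fun t => t.num)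
    (fun t => (t.den : ℤ)) (T := T) hp0 (fun t ht => by
      obtain ⟨ht, hle⟩ := mem_filter.1 ht
      obtain ⟨b1, b2, b3⟩ := hb t ht
      exact ⟨b1.le, hle, by exact_mod_cast t.den_pos, by exact_mod_cast b3⟩)
    fun t₁ h₁ t₂ h₂ hne => hsep t₁ (mem_filter.1 h₁).1 t₂ (mem_filter.1 h₂).1 hne
  have h2 := card_le_of_separated (S.filter fun t => ¬t.num ≤ (t.den : ℤ)) (fun t => (t.den : ℤ))
    (fun t => t.num) (T := T) hp0 (fun t ht => by
      obtain ⟨ht, hle⟩ := mem_filter.1 ht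
      obtain ⟨b1, b2, b3⟩ := hb t ht
      exact ⟨by positivity, (not_le.1 hle).le, b1, b2⟩)
    fun t₁ h₁ t₂ h₂ hne => by
      have h3 := hsep t₁ (mem_filter.1 h₁).1 t₂ (mem_filter.1 h₂).1 hne
      rw [abs_sub_comm] at h3
      convert h3 using 2
      ring
  have h3 : (S.card : ℝ) = (S.filter fun t => t.num ≤ (t.den : ℤ)).card +
      (S.filter fun t => ¬t.num ≤ (t.den : ℤ)).card := by
    exact_mod_cast (card_filter_add_card_filter_not (s := S) fun t => t.num ≤ (t.den : ℤ)).symm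
  rw [h3]
  linarith

/-- The elements of `F(T)` with good reduction and trace `a` modulo `p`. -/
def goodTrace (f g : ℤ[X]) (T : ℝ) (p : ℕ) (a : ℤ) : Finset ℚ :=
  (FT T).filter fun t => goodRed f g p t ∧ apE f g p t = a

theorem card_goodTrace_le_sq {f g : ℤ[X]} {T : ℝ} (hT : 1 ≤ T) (p : ℕ) (a : ℤ) :
    ((goodTrace f g T p a).card : ℝ) ≤ T ^ 2 :=
  le_trans (by exact_mod_cast card_filter_le _ _) (card_FT_le hT)

theorem card_goodTrace_le_mul {f g : ℤ[X]} (T : ℝ) {p : ℕ} [Fact p.Prime] (a : ℤ) :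
    ((goodTrace f g T p a).card : ℝ) ≤ (traceLevel f g p a).card * (2 * (T ^ 2 / p) + 2) := by
  have h := card_eq_sum_card_fiberwise (s := goodTrace f g T p a) (t := traceLevel f g p a)
    (f := redQ p) fun t ht => by
      obtain ⟨h1, h2⟩ := (mem_filter.1 ht).2
      exact mem_filter.2 ⟨mem_univ _, h1.2, h2⟩
  rw [h]
  push_cast
  rw [← nsmul_eq_mul]
  refine sum_le_card_nsmul _ _ _ fun s _ => le_trans ?_ (card_FT_redQ_eq_le T s)
  refine Nat.cast_le.2 (card_le_card fun t ht => ?_)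
  obtain ⟨h1, h2⟩ := mem_filter.1 ht
  obtain ⟨h3, h4, -⟩ := mem_filter.1 h1
  exact mem_filter.2 ⟨h3, h4.1, h2⟩

theorem card_goodTrace_le {f g : ℤ[X]} {T : ℝ} (hT : 1 ≤ T) {p : ℕ} [Fact p.Prime] {a : ℤ}
    {C₀ e : ℝ} (hC : 1 ≤ C₀) (h : ((traceLevel f g p a).card : ℝ) ≤ C₀ * (p : ℝ) ^ e) :
    ((goodTrace f g T p a).card : ℝ) ≤
      2 * C₀ * (T ^ 2 * (p : ℝ) ^ (e - 1) + T * (p : ℝ) ^ (e / 2)) := by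
  have hp0 : (0 : ℝ) < p := by exact_mod_cast (Fact.out : p.Prime).pos
  set c : ℝ := ((goodTrace f g T p a).card : ℝ)
  have h1 : c ≤ T ^ 2 := card_goodTrace_le_sq hT p a
  have h2 : c ≤ C₀ * (p : ℝ) ^ e * (2 * (T ^ 2 / p) + 2) :=
    (card_goodTrace_le_mul T a).trans (by gcongr)
  have hy : ((p : ℝ) ^ (e / 2)) ^ 2 = (p : ℝ) ^ e := by
    rw [← Real.rpow_natCast, ← Real.rpow_mul hp0.le]; norm_num
  have hy0 : 0 < (p : ℝ) ^ (e / 2) := Real.rpow_pos_of_pos hp0 _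
  have hpe : (p : ℝ) ^ e * (T ^ 2 / p) = T ^ 2 * (p : ℝ) ^ (e - 1) := by
    rw [Real.rpow_sub_one hp0.ne']; ring
  set y := (p : ℝ) ^ (e / 2)
  have h3 : c ≤ 2 * C₀ * (T ^ 2 * (p : ℝ) ^ (e - 1)) + 2 * C₀ * y ^ 2 := by
    rw [← hpe, hy]; linarith
  have h4 : 0 ≤ 2 * C₀ * (T ^ 2 * (p : ℝ) ^ (e - 1)) := by positivity
  rw [mul_add]
  rcases le_total T y with hTy | hTy
  · have h5 : T ^ 2 ≤ T * y := by nlinarith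
    nlinarith [mul_pos (by linarith : 0 < T) hy0]
  · have h5 : y ^ 2 ≤ T * y := by nlinarith
    nlinarith

theorem sum_rpow_sub_one_le {e : ℝ} (he : 1 / 2 ≤ e) (he1 : e ≤ 1) (N : ℕ) :
    ∑ n ∈ Icc 1 N, (n : ℝ) ^ (e - 1) ≤ 2 * (N : ℝ) ^ e := by
  induction N with
  | zero => simp [Real.zero_rpow (by linarith : e ≠ 0)]
  | succ N ih =>
    rw [Finset.sum_Icc_succ_top (by omega)]
    have hN : (0 : ℝ) < ((N + 1 : ℕ) : ℝ) := by positivity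
    have hN1 : (N : ℝ) = ((N + 1 : ℕ) : ℝ) * (1 + -1 / ((N + 1 : ℕ) : ℝ)) := by
      field_simp; push_cast; ring
    have hle : (1 : ℝ) ≤ ((N + 1 : ℕ) : ℝ) := by push_cast; linarith [Nat.cast_nonneg (α := ℝ) N]
    have hs : -1 ≤ -1 / ((N + 1 : ℕ) : ℝ) := by
      rw [le_div_iff₀ hN]; linarith
    have hB := rpow_one_add_le_one_add_mul_self hs (by linarith : 0 ≤ e) he1
    have h1 : (N : ℝ) ^ e ≤ ((N + 1 : ℕ) : ℝ) ^ e - e * ((N + 1 : ℕ) : ℝ) ^ (e - 1) := by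
      conv_lhs => rw [hN1]
      rw [Real.mul_rpow hN.le (by linarith), Real.rpow_sub_one hN.ne']
      calc _ ≤ ((N + 1 : ℕ) : ℝ) ^ e * (1 + e * (-1 / ((N + 1 : ℕ) : ℝ))) := by gcongr
        _ = _ := by ring
    have h2 : 0 < ((N + 1 : ℕ) : ℝ) ^ (e - 1) := Real.rpow_pos_of_pos hN _
    nlinarith

theorem sum_piSeq_eq (f g : ℤ[X]) (a : ℕ → ℤ) (T x : ℝ) :
    ∑ t ∈ FT T, (piSeq f g a t x : ℝ) =
      ∑ p ∈ (Icc 1 ⌊x⌋₊).filter Nat.Prime, ((goodTrace f g T p (a p)).card : ℝ) := by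
  simp only [piSeq, goodTrace, card_filter, Nat.cast_sum]
  rw [sum_comm, sum_filter]
  refine sum_congr rfl fun p _ => ?_
  split_ifs with hp <;> simp [hp]

theorem sum_piSeq_le {f g : ℤ[X]} {P₀ : ℕ} {C₀ e : ℝ} (hC : 1 ≤ C₀) (he : 1 / 2 ≤ e) (he1 : e ≤ 1)
    {a : ℕ → ℤ} (h : ∀ p : ℕ, ∀ _ : Fact p.Prime, P₀ ≤ p →
      ((traceLevel f g p (a p)).card : ℝ) ≤ C₀ * (p : ℝ) ^ e) {T x : ℝ} (hT : 1 ≤ T) (hx : 2 ≤ x) :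
    ∑ t ∈ FT T, (piSeq f g a t x : ℝ) ≤
      (P₀ + 4 * C₀) * (T * x ^ (1 + e / 2) + T ^ 2 * x ^ e) := by
  have hx0 : 0 < x := by linarith
  have hfl : (⌊x⌋₊ : ℝ) ≤ x := Nat.floor_le hx0.le
  rw [sum_piSeq_eq]
  have hterm : ∀ p ∈ (Icc 1 ⌊x⌋₊).filter Nat.Prime, ((goodTrace f g T p (a p)).card : ℝ) ≤
      (if p < P₀ then T ^ 2 else 0) +
        2 * C₀ * (T ^ 2 * (p : ℝ) ^ (e - 1) + T * (p : ℝ) ^ (e / 2)) := fun p hp => by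
    have hpp := (mem_filter.1 hp).2
    have := Fact.mk hpp
    split_ifs with hlt
    · have h1 := card_goodTrace_le_sq (f := f) (g := g) hT p (a p)
      have h2 : 0 ≤ 2 * C₀ * (T ^ 2 * (p : ℝ) ^ (e - 1) + T * (p : ℝ) ^ (e / 2)) := by positivity
      linarith
    · rw [zero_add]
      exact card_goodTrace_le hT hC (h p ⟨hpp⟩ (not_lt.1 hlt))
  refine (sum_le_sum hterm).trans ((sum_le_sum_of_subset_of_nonneg (filter_subset _ _)
    fun p _ _ => ?_).trans ?_)
  · split_ifs <;> positivity
  rw [sum_add_distrib, ← mul_sum, sum_add_distrib, ← mul_sum, ← mul_sum]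
  have s1 : ∑ p ∈ Icc 1 ⌊x⌋₊, (if p < P₀ then T ^ 2 else 0) ≤ P₀ * T ^ 2 := by
    rw [← sum_filter, sum_const, nsmul_eq_mul]
    have : ((Icc 1 ⌊x⌋₊).filter fun p => p < P₀).card ≤ P₀ := by
      calc _ ≤ (range P₀).card := card_le_card fun p hp => mem_range.2 (mem_filter.1 hp).2
        _ = P₀ := card_range _
    gcongr
  have s2 : ∑ p ∈ Icc 1 ⌊x⌋₊, (p : ℝ) ^ (e - 1) ≤ 2 * x ^ e :=
    (sum_rpow_sub_one_le he he1 _).trans (by gcongr)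
  have s3 : ∑ p ∈ Icc 1 ⌊x⌋₊, (p : ℝ) ^ (e / 2) ≤ x ^ (1 + e / 2) := by
    have : ∑ p ∈ Icc 1 ⌊x⌋₊, (p : ℝ) ^ (e / 2) ≤ (Icc 1 ⌊x⌋₊).card • x ^ (e / 2) := by
      refine sum_le_card_nsmul _ _ _ fun p hp => ?_
      have : (p : ℝ) ≤ x := (Nat.cast_le.2 (mem_Icc.1 hp).2).trans hfl
      gcongr
    refine this.trans ?_
    rw [Nat.card_Icc, Nat.add_sub_cancel, nsmul_eq_mul, Real.rpow_add hx0, Real.rpow_one]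
    gcongr
  have hxe : 1 ≤ x ^ e := Real.one_le_rpow (by linarith) (by linarith)
  have hT2 : 0 < T ^ 2 := by positivity
  have hX : 0 < x ^ (1 + e / 2) := by positivity
  calc _ ≤ P₀ * T ^ 2 + 2 * C₀ * (T ^ 2 * (2 * x ^ e) + T * x ^ (1 + e / 2)) := by gcongr
    _ ≤ P₀ * (T ^ 2 * x ^ e) + 2 * C₀ * (T ^ 2 * (2 * x ^ e) + T * x ^ (1 + e / 2)) := by
      gcongr
      exact le_mul_of_one_le_right hT2.le hxe
    _ ≤ _ := by
      have h1 : 0 ≤ P₀ * (T * x ^ (1 + e / 2)) := by positivity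
      have h2 : 0 ≤ C₀ * (T * x ^ (1 + e / 2)) := by positivity
      linarith

end Average

end LinSys

/-- Theorem 1.1 (Lang–Trotter on average over `F(T)`). -/
theorem LT_average_FT (f g : Polynomial ℤ) (hfg : Nondeg f g) (ε : ℝ) (hε : 0 < ε) :
    ∃ C : ℝ, 0 < C ∧ ∀ T x : ℝ, 1 ≤ T → 2 ≤ x → ∀ a : ℕ → ℤ,
      (∑ t ∈ (FT T).filter fun t => aeval t (Dpoly f g) ≠ 0, (piSeq f g a t x : ℝ)) ≤
          C * (T * x ^ (11 / 8 + ε) + T ^ 2 * x ^ ((7 : ℝ) / 8)) ∧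
        ((∀ p, a p = 0) →
          (∑ t ∈ (FT T).filter fun t => aeval t (Dpoly f g) ≠ 0, (piSeq f g a t x : ℝ)) ≤
            C * (T * x ^ (4 / 3 + ε) + T ^ 2 * x ^ ((5 : ℝ) / 6))) := by
  obtain ⟨P₀, C₀, hC, h⟩ := LinSys.exists_card_traceLevel_le hfg
  have hmono : ∀ (a : ℕ → ℤ) (T x : ℝ),
      ∑ t ∈ (FT T).filter fun t => aeval t (Dpoly f g) ≠ 0, (piSeq f g a t x : ℝ) ≤
        ∑ t ∈ FT T, (piSeq f g a t x : ℝ) := fun a T x =>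
    sum_le_sum_of_subset_of_nonneg (filter_subset _ _) fun _ _ _ => Nat.cast_nonneg _
  refine ⟨P₀ + 4 * C₀, by positivity, fun T x hT hx a => ?_⟩
  have hx1 : 1 ≤ x := by linarith
  refine ⟨(hmono a T x).trans ?_, fun ha => (hmono a T x).trans ?_⟩
  · refine (LinSys.sum_piSeq_le (e := 3 / 4) hC (by norm_num) (by norm_num)
      (fun p hp hpP => (h p hp hpP).1 (a p)) hT hx).trans ?_
    have h1 : x ^ (1 + (3 / 4 : ℝ) / 2) ≤ x ^ (11 / 8 + ε) :=
      Real.rpow_le_rpow_of_exponent_le hx1 (by linarith)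
    have h2 : x ^ (3 / 4 : ℝ) ≤ x ^ (7 / 8 : ℝ) :=
      Real.rpow_le_rpow_of_exponent_le hx1 (by norm_num)
    exact mul_le_mul_of_nonneg_left (add_le_add (mul_le_mul_of_nonneg_left h1 (by linarith))
      (mul_le_mul_of_nonneg_left h2 (sq_nonneg T))) (by positivity)
  · refine (LinSys.sum_piSeq_le (e := 2 / 3) hC (by norm_num) (by norm_num)
      (fun p hp hpP => by rw [ha p]; exact (h p hp hpP).2) hT hx).trans ?_
    have h1 : x ^ (1 + (2 / 3 : ℝ) / 2) ≤ x ^ (4 / 3 + ε) :=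
      Real.rpow_le_rpow_of_exponent_le hx1 (by linarith)
    have h2 : x ^ (2 / 3 : ℝ) ≤ x ^ (5 / 6 : ℝ) :=
      Real.rpow_le_rpow_of_exponent_le hx1 (by norm_num)
    exact mul_le_mul_of_nonneg_left (add_le_add (mul_le_mul_of_nonneg_left h1 (by linarith))
      (mul_le_mul_of_nonneg_left h2 (sq_nonneg T))) (by positivity)
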